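/- arXiv:2402.15816 — 11 statements merged into one kernel-verified Lean document; each statement's English description precedes it below -/
import Mathlib

section
/- Proposition 1 (extension to the Peano segment): Let G ⊆ ℝ² be open, f : ℝ² → ℝ continuous on G, (x₀,y₀) ∈ G, and a,b > 0 with R = [x₀−a, x₀+a] × [y₀−b, y₀+b] ⊆ G. Set M = sup_{(x,y)∈R} |f(x,y)|, and let h = a if M = 0 and h = min{a, b/M} otherwise. Then for every solution ψ of the initial value problem IVP(x₀,y₀) of y' = f(x,y) defined on an interval I ∋ x₀ with graph in G, there exists a solution Ψ of the same initial value problem defined on the whole Peano segment P_h = [x₀−h, x₀+h] with graph in G such that Ψ(x) = ψ(x) for all x ∈ I ∩ [x₀−h, x₀+h]. -/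
open Set

/-- `φ` is a solution of `y' = f(x,y)` on the set `I ⊆ ℝ` with graph in `S`:
it is differentiable at every point of `I` (one-sided at endpoints, expressed via
`HasDerivWithinAt`), its graph lies in `S`, and it satisfies the equation. -/
def IsSolOn (f : ℝ × ℝ → ℝ) (S : Set (ℝ × ℝ)) (φ : ℝ → ℝ) (I : Set ℝ) : Prop :=
  ∀ x ∈ I, (x, φ x) ∈ S ∧ HasDerivWithinAt φ (f (x, φ x)) I x

open Filter Topology

/-- A uniformly continuous bounded function on the plane is uniformly approximated by continuous
functions with the same bound that are Lipschitz in the second variable. -/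
lemma UniformContinuous.exists_lipschitz_snd_approx {g : ℝ × ℝ → ℝ} (hg : UniformContinuous g)
    {M : ℝ} (hM : ∀ p, |g p| ≤ M) {ε : ℝ} (hε : 0 < ε) :
    ∃ k : ℝ × ℝ → ℝ, Continuous k ∧ (∀ p, |k p| ≤ M) ∧
      (∃ K : NNReal, ∀ x, LipschitzWith K fun y => k (x, y)) ∧ ∀ p, |k p - g p| ≤ ε := by
  obtain ⟨δ, hδ, hgδ⟩ := Metric.uniformContinuous_iff.1 hg ε hε
  have hM0 : 0 ≤ M := (abs_nonneg _).trans (hM (0, 0))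
  set η := δ / 2
  have hη0 : 0 < η := half_pos hδ
  have hgc := hg.continuous
  refine ⟨fun p => ∫ s in (0 : ℝ)..1, g (p.1, p.2 + η * s), ?_, fun p => ?_,
    ⟨⟨η⁻¹ * (2 * M), by positivity⟩, fun x => ?_⟩, fun p => ?_⟩
  · apply intervalIntegral.continuous_parametric_intervalIntegral_of_continuous'
    simp only [Function.uncurry_def]
    fun_prop
  · simpa using intervalIntegral.norm_integral_le_of_norm_le_const (a := 0) (b := 1)
      (f := fun s => g (p.1, p.2 + η * s)) (C := M) fun s _ => hM _
  · refine LipschitzWith.of_dist_le_mul fun y z => ?_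
    have hi : ∀ u v, IntervalIntegrable (fun t => g (x, t)) MeasureTheory.volume u v :=
      fun u v => (by fun_prop : Continuous fun t => g (x, t)).intervalIntegrable u v
    have hb : ∀ u v, |∫ t in u..v, g (x, t)| ≤ M * |v - u| := fun u v =>
      intervalIntegral.norm_integral_le_of_norm_le_const (f := fun t => g (x, t)) fun t _ => hM _
    have hk : ∀ w, ∫ s in (0 : ℝ)..1, g (x, w + η * s) = η⁻¹ * ∫ t in w..w + η, g (x, t) := by
      intro w
      simpa using intervalIntegral.integral_comp_add_mul (a := 0) (b := 1)
        (fun t => g (x, t)) hη0.ne' w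
    simp only [hk, Real.dist_eq]
    change _ ≤ η⁻¹ * (2 * M) * |y - z|
    rw [← mul_sub, abs_mul, abs_of_pos (inv_pos.2 hη0), mul_assoc]
    gcongr
    rw [intervalIntegral.integral_interval_sub_interval_comm (hi _ _) (hi _ _) (hi _ _)]
    have h1 := hb y z
    have h2 := hb (y + η) (z + η)
    rw [add_sub_add_right_eq_sub] at h2
    rw [abs_sub_comm y z]
    exact (abs_sub _ _).trans (by linarith)
  · have hi : IntervalIntegrable (fun s => g (p.1, p.2 + η * s)) MeasureTheory.volume 0 1 :=
      (by fun_prop : Continuous fun s => g (p.1, p.2 + η * s)).intervalIntegrable 0 1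
    have h1 : (∫ s in (0 : ℝ)..1, g (p.1, p.2 + η * s)) - g p
        = ∫ s in (0 : ℝ)..1, (g (p.1, p.2 + η * s) - g p) := by
      rw [intervalIntegral.integral_sub hi (by simp)]
      simp
    rw [h1]
    have := intervalIntegral.norm_integral_le_of_norm_le_const (a := 0) (b := 1)
      (f := fun s => g (p.1, p.2 + η * s) - g p) (C := ε) fun s hs => ?_
    · simpa using this
    · rw [uIoc_of_le zero_le_one] at hs
      refine (hgδ ?_).le
      have : |η * s| < δ := by
        rw [abs_of_pos (mul_pos hη0 hs.1)]
        exact (mul_le_of_le_one_right hη0.le hs.2).trans_lt (half_lt_self hδ)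
      simpa [Prod.dist_eq, hδ] using this

/-- Pointwise cluster points of approximate solutions are solutions. -/
lemma exists_isSolOn_of_approx {ι : Type*} (l : Filter ι) [l.NeBot] {g : ℝ × ℝ → ℝ}
    (hg : UniformContinuous g) {M : ℝ} {P : Set ℝ} (hP : Convex ℝ P) {c y : ℝ} (hc : c ∈ P)
    (Y d : ι → ℝ → ℝ) (hYc : ∀ i, Y i c = y)
    (hY : ∀ i, ∀ x ∈ P, HasDerivWithinAt (Y i) (d i x) P x)
    (hd : ∀ i, ∀ x ∈ P, |d i x| ≤ M)
    (hdg : ∀ ε > 0, ∀ᶠ i in l, ∀ x ∈ P, |d i x - g (x, Y i x)| ≤ ε) :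
    ∃ Z : ℝ → ℝ, IsSolOn g univ Z P ∧ ∀ x ∈ P, ∀ v, (∀ᶠ i in l, Y i x = v) → Z x = v := by
  have hM0 : 0 ≤ M := by
    obtain ⟨i⟩ := l.nonempty_of_neBot
    exact (abs_nonneg _).trans (hd i c hc)
  have hlip : ∀ i, ∀ x ∈ P, ∀ x' ∈ P, |Y i x' - Y i x| ≤ M * |x' - x| := fun i x hx x' hx' =>
    hP.norm_image_sub_le_of_norm_hasDerivWithin_le (hY i) (hd i) hx hx'
  let u : Ultrafilter ι := Ultrafilter.of l
  have hul : (u : Filter ι) ≤ l := Ultrafilter.of_le l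
  have hlim : ∀ x ∈ P, ∃ z, Tendsto (fun i => Y i x) u (𝓝 z) := by
    intro x hx
    obtain ⟨z, -, hz⟩ := (isCompact_closedBall y (M * |x - c|)).ultrafilter_le_nhds'
      (u.map fun i => Y i x) (Filter.Eventually.of_forall (f := (u : Filter ι)) fun i => by
        simpa [Real.dist_eq, hYc] using hlip i c hc x hx)
    exact ⟨z, hz⟩
  choose! Z hZ using hlim
  refine ⟨Z, fun x hx => ⟨mem_univ _, ?_⟩, fun x hx v hv => ?_⟩
  · rw [hasDerivWithinAt_iff_isLittleO, Asymptotics.isLittleO_iff]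
    intro ε hε
    obtain ⟨δ, hδ, hgδ⟩ := Metric.uniformContinuous_iff.1 hg (ε / 2) (half_pos hε)
    have hr : 0 < δ / (M + 1) := by positivity
    filter_upwards [self_mem_nhdsWithin, mem_nhdsWithin_of_mem_nhds (Metric.ball_mem_nhds x hr)]
      with x' hx' hxr
    have hlimx : Tendsto (fun i => ‖Y i x' - Y i x - (x' - x) • g (x, Y i x)‖) u
        (𝓝 ‖Z x' - Z x - (x' - x) • g (x, Z x)‖) := by
      have hgx : Tendsto (fun i => g (x, Y i x)) u (𝓝 (g (x, Z x))) :=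
        (hg.continuous.tendsto _).comp (tendsto_const_nhds.prodMk_nhds (hZ x hx))
      exact (((hZ x' hx').sub (hZ x hx)).sub (hgx.const_smul _)).norm
    refine le_of_tendsto hlimx ?_
    filter_upwards [hul (hdg (ε / 2) (half_pos hε))] with i hi
    set Q := P ∩ Metric.ball x (δ / (M + 1))
    have hQ : Convex ℝ Q := hP.inter (convex_ball _ _)
    set G := g (x, Y i x)
    have key := hQ.norm_image_sub_le_of_norm_hasDerivWithin_le (𝕜 := ℝ)
      (f := fun t => Y i t - t * G) (f' := fun t => d i t - 1 * G) (C := ε) (x := x) (y := x')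
      (fun t ht => ((hY i t ht.1).mono inter_subset_left).sub
        ((hasDerivWithinAt_id t Q).mul_const G))
      (fun t ht => ?_) ⟨hx, Metric.mem_ball_self hr⟩ ⟨hx', hxr⟩
    · refine le_trans (le_of_eq ?_) key
      congr 1
      simp only [smul_eq_mul]
      ring
    · have h1 := hi t ht.1
      have ht2 : |t - x| < δ / (M + 1) := ht.2
      rw [lt_div_iff₀ (by positivity)] at ht2
      have h3 := hlip i x hx t ht.1
      have h2 : |g (t, Y i t) - G| < ε / 2 := by
        apply hgδ
        simp only [Prod.dist_eq, Real.dist_eq]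
        apply max_lt <;> nlinarith [abs_nonneg (t - x)]
      rw [Real.norm_eq_abs, one_mul]
      have := abs_sub_le (d i t) (g (t, Y i t)) G
      linarith
  · refine tendsto_nhds_unique (hZ x hx) (tendsto_const_nhds.congr' ?_)
    filter_upwards [hul hv] with i hi using hi.symm

/-- **Peano's existence theorem** for a bounded, uniformly continuous right-hand side. -/
lemma exists_isSolOn_Icc {g : ℝ × ℝ → ℝ} (hg : UniformContinuous g) {M : ℝ}
    (hM : ∀ p, |g p| ≤ M) {p q c : ℝ} (hc : c ∈ Icc p q) (y : ℝ) :
    ∃ Y : ℝ → ℝ, Y c = y ∧ IsSolOn g univ Y (Icc p q) := by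
  have hM0 : 0 ≤ M := (abs_nonneg _).trans (hM (0, 0))
  have happ : ∀ n : ℕ, ∃ Y d : ℝ → ℝ, Y c = y ∧
      (∀ x ∈ Icc p q, HasDerivWithinAt Y (d x) (Icc p q) x) ∧ (∀ x, |d x| ≤ M) ∧
      ∀ x, |d x - g (x, Y x)| ≤ 1 / ((n : ℝ) + 1) := by
    intro n
    obtain ⟨k, hkc, hkM, ⟨K, hkK⟩, hkg⟩ :=
      hg.exists_lipschitz_snd_approx hM (Nat.one_div_pos_of_nat (α := ℝ) (n := n))
    have hmax : 0 ≤ max (q - c) (c - p) := le_max_of_le_left (sub_nonneg.2 hc.2)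
    have hPL : IsPicardLindelof (fun t z => k (t, z)) (⟨c, hc⟩ : Icc p q) y
        ⟨M * max (q - c) (c - p), by positivity⟩ 0 ⟨M, hM0⟩ K :=
      { lipschitzOnWith := fun t _ => (hkK t).lipschitzOnWith
        continuousOn := fun x _ => (by fun_prop : Continuous fun t => k (t, x)).continuousOn
        norm_le := fun t _ x _ => hkM _
        mul_max_le := by rw [NNReal.coe_zero, sub_zero]; rfl }
    obtain ⟨Y, hYc, hY⟩ := hPL.exists_eq_forall_mem_Icc_hasDerivWithinAt₀
    exact ⟨Y, fun x => k (x, Y x), hYc, hY, fun x => hkM _, fun x => hkg _⟩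
  choose Y d hYc hY hd hdg using happ
  obtain ⟨Z, hZ, hZv⟩ := exists_isSolOn_of_approx atTop hg (convex_Icc p q) hc Y d hYc hY
    (fun n x _ => hd n x) fun ε hε => by
      filter_upwards [(tendsto_one_div_add_atTop_nhds_zero_nat (𝕜 := ℝ)).eventually_le_const hε]
        with n hn x _ using (hdg n x).trans hn
  exact ⟨Z, hZv c hc y (Eventually.of_forall hYc), hZ⟩

/-- Solutions on adjacent closed intervals that agree at the common endpoint can be glued. -/
lemma IsSolOn.glue {g : ℝ × ℝ → ℝ} {S : Set (ℝ × ℝ)} {u v : ℝ → ℝ} {p r q : ℝ}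
    (hu : IsSolOn g S u (Icc p r)) (hv : IsSolOn g S v (Icc r q)) (hpr : p ≤ r) (hrq : r ≤ q)
    (huv : u r = v r) : IsSolOn g S (fun x => if x ≤ r then u x else v x) (Icc p q) := by
  set w : ℝ → ℝ := fun x => if x ≤ r then u x else v x
  have hwu : ∀ x ∈ Icc p r, w x = u x := fun x hx => if_pos hx.2
  have hwv : ∀ x ∈ Icc r q, w x = v x := by
    intro x hx
    rcases hx.1.eq_or_lt with rfl | h
    · exact (hwu _ ⟨hpr, le_rfl⟩).trans huv
    · exact if_neg h.not_ge
  have hul : ∀ x ∈ Icc p r, (x, w x) ∈ S ∧ HasDerivWithinAt w (g (x, w x)) (Icc p r) x := by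
    intro x hx
    rw [hwu x hx]
    exact ⟨(hu x hx).1, (hu x hx).2.congr hwu (hwu x hx)⟩
  have hvl : ∀ x ∈ Icc r q, (x, w x) ∈ S ∧ HasDerivWithinAt w (g (x, w x)) (Icc r q) x := by
    intro x hx
    rw [hwv x hx]
    exact ⟨(hv x hx).1, (hv x hx).2.congr hwv (hwv x hx)⟩
  intro x hx
  rcases lt_trichotomy x r with h | rfl | h
  · refine ⟨(hul x ⟨hx.1, h.le⟩).1, (hul x ⟨hx.1, h.le⟩).2.mono_of_mem_nhdsWithin ?_⟩
    filter_upwards [self_mem_nhdsWithin, mem_nhdsWithin_of_mem_nhds (Iio_mem_nhds h)]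
      with t ht htr using ⟨ht.1, le_of_lt htr⟩
  · refine ⟨(hul x ⟨hpr, le_rfl⟩).1, ?_⟩
    rw [← Icc_union_Icc_eq_Icc hpr hrq]
    exact (hul x ⟨hpr, le_rfl⟩).2.union (hvl x ⟨le_rfl, hrq⟩).2
  · refine ⟨(hvl x ⟨h.le, hx.2⟩).1, (hvl x ⟨h.le, hx.2⟩).2.mono_of_mem_nhdsWithin ?_⟩
    filter_upwards [self_mem_nhdsWithin, mem_nhdsWithin_of_mem_nhds (Ioi_mem_nhds h)]
      with t ht htr using ⟨le_of_lt htr, ht.2⟩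

/-- The restriction of a solution to a subset of its domain is a solution. -/
lemma IsSolOn.mono {g : ℝ × ℝ → ℝ} {S : Set (ℝ × ℝ)} {u : ℝ → ℝ} {I J : Set ℝ}
    (hu : IsSolOn g S u I) (hJ : J ⊆ I) : IsSolOn g S u J :=
  fun x hx => ⟨(hu x (hJ hx)).1, (hu x (hJ hx)).2.mono hJ⟩

/-- A solution on a closed subinterval extends to the whole interval when the right-hand side is
bounded and uniformly continuous. -/
lemma IsSolOn.exists_extension_Icc {g : ℝ × ℝ → ℝ} (hg : UniformContinuous g) {M : ℝ}
    (hM : ∀ p, |g p| ≤ M) {p α β q : ℝ} (hpα : p ≤ α) (hαβ : α ≤ β) (hβq : β ≤ q) {u : ℝ → ℝ}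
    (hu : IsSolOn g univ u (Icc α β)) :
    ∃ w : ℝ → ℝ, IsSolOn g univ w (Icc p q) ∧ ∀ x ∈ Icc α β, w x = u x := by
  obtain ⟨v₁, hv₁, hs₁⟩ := exists_isSolOn_Icc hg hM (right_mem_Icc.2 hpα) (u α)
  obtain ⟨v₂, hv₂, hs₂⟩ := exists_isSolOn_Icc hg hM (left_mem_Icc.2 hβq) (u β)
  have h₂ := hu.glue hs₂ hαβ hβq hv₂.symm
  refine ⟨_, hs₁.glue h₂ hpα (hαβ.trans hβq) (by simp [hαβ, hv₁]), fun x hx => ?_⟩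
  rcases hx.1.eq_or_lt with rfl | h
  · simp [hv₁]
  · simp [h.not_ge, hx.2]

/-- If the speed of a curve starting at `0` is at most `M` as long as the curve stays in `[-b, b]`,
then the curve stays in `[-b, b]` up to time `b / M`. -/
lemma abs_le_of_abs_deriv_le {φ d : ℝ → ℝ} {s b M : ℝ} (hb : 0 < b) (hM : 0 ≤ M)
    (hMs : M * s ≤ b) (h0 : φ 0 = 0)
    (hφ : ∀ t ∈ Icc 0 s, HasDerivWithinAt φ (d t) (Icc 0 s) t)
    (hd : ∀ t ∈ Icc 0 s, |φ t| ≤ b → |d t| ≤ M) : ∀ t ∈ Icc 0 s, |φ t| ≤ b := by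
  have hcont : ContinuousOn φ (Icc 0 s) := fun t ht => (hφ t ht).continuousWithinAt
  have hlt : ∀ r ∈ Ico 0 s, |φ r| ≤ b := by
    intro r hr
    have hMr : M * r < b := by
      rcases hM.eq_or_lt with rfl | h
      · simpa using hb
      · nlinarith [hr.2]
    have hr1 : 0 < r + 1 := by linarith [hr.1]
    set ε := (b - M * r) / (r + 1)
    have hε0 : 0 < ε := div_pos (by linarith) hr1
    have hεr : (M + ε) * r ≤ b := by
      have : ε * (r + 1) = b - M * r := div_mul_cancel₀ _ hr1.ne'
      nlinarith
    have key := image_norm_le_of_norm_deriv_right_lt_deriv_boundary' (f := φ) (f' := d)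
      (a := 0) (b := r) (B := fun t => (M + ε) * t) (B' := fun _ => M + ε)
      (hcont.mono (Icc_subset_Icc_right hr.2.le)) (fun t ht => ?_) (by simp [h0])
      (by fun_prop) (fun t _ => by simpa using ((hasDerivWithinAt_id t (Ici t)).const_mul (M + ε)))
      (fun t ht hBt => ?_) (right_mem_Icc.2 hr.1)
    · exact key.trans hεr
    · refine (hφ t ⟨ht.1, (ht.2.trans hr.2).le⟩).mono_of_mem_nhdsWithin ?_
      filter_upwards [self_mem_nhdsWithin,
        mem_nhdsWithin_of_mem_nhds (Iio_mem_nhds (ht.2.trans hr.2))]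
        with z hz hzs using ⟨ht.1.trans hz, le_of_lt hzs⟩
    · have : |d t| ≤ M := by
        refine hd t ⟨ht.1, (ht.2.trans hr.2).le⟩ ?_
        have : |φ t| = (M + ε) * t := hBt
        rw [this]
        exact (mul_le_mul_of_nonneg_left ht.2.le (by positivity)).trans hεr
      exact this.trans_lt (by linarith)
  intro t ht
  rcases ht.2.lt_or_eq with h | rfl
  · exact hlt t ⟨ht.1, h⟩
  · rcases ht.1.eq_or_lt with rfl | h
    · simpa [h0] using hb.le
    · refine ContinuousWithinAt.closure_le (s := Ico 0 t) (f := fun z => |φ z|) (g := fun _ => b)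
        ?_ ((hcont t ht).mono Ico_subset_Icc_self).abs continuousWithinAt_const hlt
      rw [closure_Ico h.ne]
      exact ht

/-- A continuous function on a closed rectangle extends to a uniformly continuous function on the
plane with the same bound. -/
lemma exists_uniformContinuous_extension {f : ℝ × ℝ → ℝ} {p q r s M : ℝ} (hpq : p ≤ q) (hrs : r ≤ s)
    (hf : ContinuousOn f (Icc p q ×ˢ Icc r s)) (hM : ∀ z ∈ Icc p q ×ˢ Icc r s, |f z| ≤ M) :
    ∃ g : ℝ × ℝ → ℝ, UniformContinuous g ∧ (∀ z, |g z| ≤ M) ∧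
      ∀ z ∈ Icc p q ×ˢ Icc r s, g z = f z := by
  let π : ℝ × ℝ → ℝ × ℝ := fun z => (projIcc p q hpq z.1, projIcc r s hrs z.2)
  have hπR : ∀ z, π z ∈ Icc p q ×ˢ Icc r s := fun z => ⟨Subtype.coe_prop _, Subtype.coe_prop _⟩
  have hπ : UniformContinuous π :=
    (uniformContinuous_subtype_val.comp
      ((LipschitzWith.projIcc hpq).uniformContinuous.comp uniformContinuous_fst)).prodMk
    (uniformContinuous_subtype_val.comp
      ((LipschitzWith.projIcc hrs).uniformContinuous.comp uniformContinuous_snd))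
  have hfu := (isCompact_Icc.prod isCompact_Icc).uniformContinuousOn_of_continuous hf
  refine ⟨f ∘ π, ?_, fun z => hM _ (hπR z), fun z hz => ?_⟩
  · exact (uniformContinuousOn_iff_restrict.1 hfu).comp (hπ.subtype_mk hπR)
  · have : π z = z := by
      ext
      · simp [π, projIcc_of_mem hpq hz.1]
      · simp [π, projIcc_of_mem hrs hz.2]
    simp [this]

/-- On the Peano segment a solution of the initial value problem stays in the rectangle. -/
lemma IsSolOn.abs_sub_le {f : ℝ × ℝ → ℝ} {S : Set (ℝ × ℝ)} {x₀ y₀ a b M h : ℝ} (hb : 0 < b)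
    (hM0 : 0 ≤ M) (hM : ∀ z ∈ Icc (x₀ - a) (x₀ + a) ×ˢ Icc (y₀ - b) (y₀ + b), |f z| ≤ M)
    (hha : h ≤ a) (hMh : M * h ≤ b) {I : Set ℝ} (hI : I.OrdConnected) (hx₀ : x₀ ∈ I) {u : ℝ → ℝ}
    (hu₀ : u x₀ = y₀) (hu : IsSolOn f S u I) {x : ℝ} (hx : x ∈ I ∩ Icc (x₀ - h) (x₀ + h)) :
    |u x - y₀| ≤ b := by
  have hσ : ∀ σ s : ℝ, |σ| = 1 → 0 ≤ s → s ≤ h → (∀ t ∈ Icc 0 s, x₀ + σ * t ∈ I) →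
      |u (x₀ + σ * s) - y₀| ≤ b := by
    intro σ s hσ hs0 hsh hsI
    refine abs_le_of_abs_deriv_le (φ := fun t => u (x₀ + σ * t) - y₀)
      (d := fun t => f (x₀ + σ * t, u (x₀ + σ * t)) * σ) hb hM0
      ((mul_le_mul_of_nonneg_left hsh hM0).trans hMh) (by simp [hu₀]) (fun t ht => ?_)
      (fun t ht htb => ?_) s (right_mem_Icc.2 hs0)
    · have hin : HasDerivWithinAt (fun t => x₀ + σ * t) σ (Icc 0 s) t := by
        simpa using ((hasDerivWithinAt_id t (Icc 0 s)).const_mul σ).const_add x₀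
      exact ((hu _ (hsI t ht)).2.comp t hin hsI).sub_const y₀
    · rw [abs_mul, hσ, mul_one]
      have hta : |σ * t| ≤ a := by
        rw [abs_mul, hσ, one_mul, abs_of_nonneg ht.1]
        exact ht.2.trans (hsh.trans hha)
      rw [abs_le] at hta htb
      exact hM _ ⟨⟨by linarith, by linarith⟩, ⟨by linarith, by linarith⟩⟩
  obtain ⟨hxI, hx1, hx2⟩ := hx
  rcases le_total x₀ x with hle | hle
  · have := hσ 1 (x - x₀) (by simp) (by linarith) (by linarith) fun t ht =>
      hI.out hx₀ hxI ⟨by linarith [ht.1], by linarith [ht.2]⟩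
    simpa using this
  · have := hσ (-1) (x₀ - x) (by simp) (by linarith) (by linarith) fun t ht =>
      hI.out hxI hx₀ ⟨by linarith [ht.2], by linarith [ht.1]⟩
    simpa using this

/-- Proposition 1: every solution of the interior initial value problem IVP(x₀,y₀)
extends to a solution defined on the whole Peano segment `[x₀ - h, x₀ + h]`. -/
theorem extension_to_peano_segment
    (G : Set (ℝ × ℝ)) (hG : IsOpen G) (f : ℝ × ℝ → ℝ) (hf : ContinuousOn f G)
    (x₀ y₀ a b : ℝ) (ha : 0 < a) (hb : 0 < b) (h₀ : (x₀, y₀) ∈ G)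
    (hR : Icc (x₀ - a) (x₀ + a) ×ˢ Icc (y₀ - b) (y₀ + b) ⊆ G)
    (M : ℝ)
    (hM : M = sSup ((fun p => |f p|) '' (Icc (x₀ - a) (x₀ + a) ×ˢ Icc (y₀ - b) (y₀ + b))))
    (h : ℝ) (hh : h = if M = 0 then a else min a (b / M)) :
    ∀ (I : Set ℝ) (ψ : ℝ → ℝ), I.OrdConnected → x₀ ∈ I → ψ x₀ = y₀ →
      IsSolOn f G ψ I →
      ∃ Ψ : ℝ → ℝ, Ψ x₀ = y₀ ∧ IsSolOn f G Ψ (Icc (x₀ - h) (x₀ + h)) ∧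
        ∀ x ∈ I ∩ Icc (x₀ - h) (x₀ + h), Ψ x = ψ x := by
  intro I ψ hI hx₀ hψ₀ hψ
  set R := Icc (x₀ - a) (x₀ + a) ×ˢ Icc (y₀ - b) (y₀ + b)
  have hMR : ∀ z ∈ R, |f z| ≤ M := fun z hz => hM ▸
    le_csSup ((isCompact_Icc.prod isCompact_Icc).bddAbove_image (hf.mono hR).abs)
      (mem_image_of_mem _ hz)
  have hM0 : 0 ≤ M := (abs_nonneg _).trans
    (hMR (x₀, y₀) ⟨⟨by linarith, by linarith⟩, ⟨by linarith, by linarith⟩⟩)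
  obtain ⟨hh0, hha, hMh⟩ : 0 < h ∧ h ≤ a ∧ M * h ≤ b := by
    rcases hM0.eq_or_lt' with hM' | hM'
    · simp [hh, hM', ha, hb.le]
    · rw [hh, if_neg hM'.ne']
      refine ⟨lt_min ha (div_pos hb hM'), min_le_left _ _, ?_⟩
      rw [mul_comm, ← le_div_iff₀ hM']
      exact min_le_right _ _
  obtain ⟨g, hgu, hgM, hgf⟩ := exists_uniformContinuous_extension (by linarith) (by linarith)
    (hf.mono hR) hMR
  set P := Icc (x₀ - h) (x₀ + h)
  have hx₀P : x₀ ∈ P := ⟨by linarith, by linarith⟩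
  have hmemR : ∀ x ∈ P, ∀ y, |y - y₀| ≤ b → (x, y) ∈ R := fun x hx y hy => by
    rw [abs_le] at hy
    exact ⟨⟨by linarith [hx.1], by linarith [hx.2]⟩, ⟨by linarith, by linarith⟩⟩
  set J := I ∩ P
  have hJ : J.OrdConnected := hI.inter ordConnected_Icc
  have hψg : IsSolOn g univ ψ J := fun x hx => by
    refine ⟨mem_univ _, ?_⟩
    rw [hgf _ (hmemR x hx.2 _ (hψ.abs_sub_le hb hM0 hMR hha hMh hI hx₀ hψ₀ hx))]
    exact (hψ x hx.1).2.mono inter_subset_left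
  have hx₀J : x₀ ∈ J := ⟨hx₀, hx₀P⟩
  have hext : ∀ i : J × J, ∃ w : ℝ → ℝ, IsSolOn g univ w P ∧ w x₀ = y₀ ∧
      ∀ x ∈ Icc (i.1 : ℝ) i.2, w x = ψ x := by
    rintro ⟨⟨α, hα⟩, ⟨β, hβ⟩⟩
    have hα' : min α x₀ ∈ J := by rcases min_choice α x₀ with h | h <;> rwa [h]
    have hβ' : max β x₀ ∈ J := by rcases max_choice β x₀ with h | h <;> rwa [h]
    obtain ⟨w, hw, hwψ⟩ := (hψg.mono (hJ.out hα' hβ')).exists_extension_Icc hgu hgM hα'.2.1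
      ((min_le_right _ _).trans (le_max_right _ _)) hβ'.2.2
    exact ⟨w, hw, (hwψ _ ⟨min_le_right _ _, le_max_right _ _⟩).trans hψ₀, fun x hx =>
      hwψ x ⟨(min_le_left _ _).trans hx.1, hx.2.trans (le_max_left _ _)⟩⟩
  choose Y hY hY₀ hYψ using hext
  have : Nonempty J := ⟨⟨x₀, hx₀J⟩⟩
  obtain ⟨Z, hZ, hZv⟩ := exists_isSolOn_of_approx (atBot ×ˢ atTop : Filter (J × J)) hgu
    (convex_Icc _ _) hx₀P Y (fun i x => g (x, Y i x)) hY₀ (fun i x hx => (hY i x hx).2)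
    (fun i x _ => hgM _) fun ε hε => Eventually.of_forall fun i x _ => by simpa using hε.le
  have hZ₀ : Z x₀ = y₀ := hZv x₀ hx₀P y₀ (Eventually.of_forall hY₀)
  refine ⟨Z, hZ₀, fun x hx => ?_, fun x hx => hZv x hx.2 _ ?_⟩
  · have hZb := hZ.abs_sub_le hb hM0 (fun z _ => hgM z) hha hMh ordConnected_Icc hx₀P hZ₀
      (mem_inter hx hx)
    have hxR := hmemR x hx _ hZb
    exact ⟨hR hxR, hgf _ hxR ▸ (hZ x hx).2⟩
  · filter_upwards [(eventually_le_atBot (⟨x, hx⟩ : J)).prod_mk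
      (eventually_ge_atTop (⟨x, hx⟩ : J))] with i hi using hYψ i x hi
end

section
/- Proposition 2 (min and max of solutions are solutions): Let G ⊆ ℝ² be open and f : ℝ² → ℝ continuous on G. If χ₁ and χ₂ are solutions of y' = f(x,y) on a common interval I with graphs in G, then the functions x ↦ min{χ₁(x), χ₂(x)} and x ↦ max{χ₁(x), χ₂(x)} are also solutions of y' = f(x,y) on I with graphs in G. -/
open Set

theorem HasDerivWithinAt.of_eq_or_eq {φ ψ g : ℝ → ℝ} {d x : ℝ} {I : Set ℝ}
    (hφ : HasDerivWithinAt φ d I x) (hψ : HasDerivWithinAt ψ d I x) (hx : φ x = ψ x)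
    (hg : ∀ y, g y = φ y ∨ g y = ψ y) : HasDerivWithinAt g d I x := by
  rw [hasDerivWithinAt_iff_isLittleO, Asymptotics.isLittleO_iff] at *
  intro c hc
  have hgx : g x = φ x := (hg x).elim id fun h => h.trans hx.symm
  filter_upwards [hφ hc, hψ hc] with y h₁ h₂
  rcases hg y with h | h
  · rwa [h, hgx]
  · rwa [h, hgx, hx]

theorem IsSolOn.continuousOn {f : ℝ × ℝ → ℝ} {S : Set (ℝ × ℝ)} {φ : ℝ → ℝ} {I : Set ℝ}
    (h : IsSolOn f S φ I) : ContinuousOn φ I :=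
  fun x hx => (h x hx).2.continuousWithinAt

/-- A continuous function that agrees at every point with one of two solutions is a solution. -/
theorem IsSolOn.of_eq_or_eq {f : ℝ × ℝ → ℝ} {S : Set (ℝ × ℝ)} {φ ψ g : ℝ → ℝ} {I : Set ℝ}
    (hφ : IsSolOn f S φ I) (hψ : IsSolOn f S ψ I) (hc : ContinuousOn g I)
    (hg : ∀ y, g y = φ y ∨ g y = ψ y) : IsSolOn f S g I := by
  intro x hx
  obtain ⟨hφS, hφd⟩ := hφ x hx
  obtain ⟨hψS, hψd⟩ := hψ x hx
  by_cases hne : φ x = ψ x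
  · have hgx : g x = φ x := (hg x).elim id fun h => h.trans hne.symm
    rw [hgx]
    rw [← hne] at hψd
    exact ⟨hφS, hφd.of_eq_or_eq hψd hne hg⟩
  · rcases hg x with hgx | hgx
    · rw [hgx]
      refine ⟨hφS, hφd.congr_of_eventuallyEq ?_ hgx⟩
      filter_upwards [((hc x hx).sub (hψ.continuousOn x hx)).eventually_ne
        (sub_ne_zero.2 (hgx.trans_ne hne))] with y hy
      exact (hg y).resolve_right (sub_ne_zero.1 hy)
    · rw [hgx]
      refine ⟨hψS, hψd.congr_of_eventuallyEq ?_ hgx⟩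
      filter_upwards [((hc x hx).sub (hφ.continuousOn x hx)).eventually_ne
        (sub_ne_zero.2 (hgx.trans_ne (Ne.symm hne)))] with y hy
      exact (hg y).resolve_left (sub_ne_zero.1 hy)

/-- Proposition 2: the pointwise minimum and maximum of two solutions of
`y' = f(x,y)` on a common interval `I` with graphs in the open set `G` are again
solutions on `I` with graphs in `G`. -/
theorem min_max_of_solutions_are_solutions
    (G : Set (ℝ × ℝ)) (hG : IsOpen G) (f : ℝ × ℝ → ℝ) (hf : ContinuousOn f G)
    (I : Set ℝ) (hI : I.OrdConnected) (χ₁ χ₂ : ℝ → ℝ)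
    (h₁ : IsSolOn f G χ₁ I) (h₂ : IsSolOn f G χ₂ I) :
    IsSolOn f G (fun x => min (χ₁ x) (χ₂ x)) I ∧
    IsSolOn f G (fun x => max (χ₁ x) (χ₂ x)) I := by
  exact ⟨h₁.of_eq_or_eq h₂ (ContinuousOn.inf h₁.continuousOn h₂.continuousOn)
      fun _ => min_choice _ _,
    h₁.of_eq_or_eq h₂ (ContinuousOn.sup h₁.continuousOn h₂.continuousOn)
      fun _ => max_choice _ _⟩
end

section
/- Theorem on uniqueness set: Let G ⊆ ℝ² be open, Ĝ ⊆ ∂G, G̃ = G ∪ Ĝ, and f : ℝ² → ℝ continuous on G̃. Let G° ⊆ G be open, Ĝ° ⊆ ∂G° ∩ Ĝ, and G̃° = G° ∪ Ĝ°. Assume f is locally Lipschitz in y on G̃° relative to G̃: for every p ∈ G̃° there exist c > 0 and L > 0 such that |f(x,y₁) − f(x,y₂)| ≤ L|y₁ − y₂| whenever (x,y₁) and (x,y₂) belong to G̃ ∩ ([p₁−c, p₁+c] × [p₂−c, p₂+c]), where p = (p₁,p₂). Then every point (x₀,y₀) ∈ G̃° is a uniqueness point: for any two solutions φ₁, φ₂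 of the initial value problem IVP(x₀,y₀) of y' = f(x,y) with graphs in G̃, defined on intervals I₁ ∋ x₀ and I₂ ∋ x₀, there exists δ > 0 such that φ₁(x) = φ₂(x) for all x ∈ I₁ ∩ I₂ ∩ [x₀−δ, x₀+δ]. -/
open Set

/-- One-sided Gronwall uniqueness: a function on `[a, b]` vanishing at `a` whose derivative
is bounded by a multiple of its absolute value vanishes on `[a, b]`. -/
theorem eq_zero_of_abs_derivWithin_le_Icc {g g' : ℝ → ℝ} {a b L : ℝ} (hab : a ≤ b)
    (hg : ∀ x ∈ Icc a b, HasDerivWithinAt g (g' x) (Icc a b) x)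
    (hL : ∀ x ∈ Icc a b, |g' x| ≤ L * |g x|) (ha : g a = 0) : g b = 0 := by
  refine eq_zero_of_abs_deriv_le_mul_abs_self_of_eq_zero_right (f' := g') (K := L)
    (fun x hx => (hg x hx).continuousWithinAt) (fun x hx => ?_) ha
    (fun x hx => hL x (Ico_subset_Icc_self hx)) b (right_mem_Icc.2 hab)
  exact (hg x (Ico_subset_Icc_self hx)).mono_of_mem_nhdsWithin
    (Icc_mem_nhdsGE_of_mem hx)

/-- Two-sided Gronwall uniqueness on an arbitrary interval. -/
theorem eq_zero_of_abs_derivWithin_le_ordConnected {g g' : ℝ → ℝ} {J : Set ℝ} {a L : ℝ}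
    (hJ : J.OrdConnected) (haJ : a ∈ J)
    (hg : ∀ x ∈ J, HasDerivWithinAt g (g' x) J x)
    (hL : ∀ x ∈ J, |g' x| ≤ L * |g x|) (ha : g a = 0) : ∀ x ∈ J, g x = 0 := by
  intro b hb
  rcases le_total a b with hab | hba
  · have hs : Icc a b ⊆ J := hJ.out haJ hb
    exact eq_zero_of_abs_derivWithin_le_Icc hab (fun x hx => (hg x (hs hx)).mono hs)
      (fun x hx => hL x (hs hx)) ha
  · have hs : Icc b a ⊆ J := hJ.out hb haJ
    have hmaps : MapsTo (fun x : ℝ => -x) (Icc (-a) (-b)) J := fun x hx =>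
      hs ⟨le_neg.1 hx.2, neg_le.1 hx.1⟩
    have key := eq_zero_of_abs_derivWithin_le_Icc (g := fun x => g (-x))
      (g' := fun x => -g' (-x)) (L := L) (neg_le_neg hba) (fun x hx => ?_) (fun x hx => ?_)
      (by simpa using ha)
    · simpa using key
    · have := (hg (-x) (hmaps hx)).scomp x (hasDerivAt_neg x).hasDerivWithinAt hmaps
      simpa [Function.comp_def] using this
    · simpa using hL (-x) (hmaps hx)

/-- A function continuous within `I` at `a` stays within `c` of its value at `a` on the
points of `I` close to `a`. -/
theorem ContinuousWithinAt.exists_forall_mem_Icc {φ : ℝ → ℝ} {I : Set ℝ} {a c : ℝ}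
    (h : ContinuousWithinAt φ I a) (hc : 0 < c) :
    ∃ δ > 0, ∀ x ∈ I, x ∈ Icc (a - δ) (a + δ) → φ x ∈ Icc (φ a - c) (φ a + c) := by
  obtain ⟨d, hd, h⟩ := Metric.continuousWithinAt_iff.1 h c hc
  refine ⟨d / 2, half_pos hd, fun x hx hxd => ?_⟩
  have hdist : dist x a < d := by
    rw [Real.dist_eq, abs_lt]
    constructor <;> linarith [hxd.1, hxd.2]
  have := abs_lt.1 (h hx hdist)
  constructor <;> linarith [this.1, this.2]

/-- Theorem on uniqueness set: if `f` is continuous on `G̃ = G ∪ Ĝ` and locally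
Lipschitz in `y` on `G̃° = G° ∪ Ĝ°` relative to `G̃`, then every point of `G̃°`
is a uniqueness point. -/
theorem uniqueness_set
    (G Ghat : Set (ℝ × ℝ)) (hG : IsOpen G) (hGhat : Ghat ⊆ frontier G)
    (f : ℝ × ℝ → ℝ) (hf : ContinuousOn f (G ∪ Ghat))
    (G₀ Ghat₀ : Set (ℝ × ℝ)) (hG₀open : IsOpen G₀) (hG₀ : G₀ ⊆ G)
    (hGhat₀ : Ghat₀ ⊆ frontier G₀ ∩ Ghat)
    (hLip : ∀ p ∈ G₀ ∪ Ghat₀, ∃ c > 0, ∃ L > 0, ∀ x y₁ y₂ : ℝ,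
      (x, y₁) ∈ (G ∪ Ghat) ∩ (Icc (p.1 - c) (p.1 + c) ×ˢ Icc (p.2 - c) (p.2 + c)) →
      (x, y₂) ∈ (G ∪ Ghat) ∩ (Icc (p.1 - c) (p.1 + c) ×ˢ Icc (p.2 - c) (p.2 + c)) →
      |f (x, y₁) - f (x, y₂)| ≤ L * |y₁ - y₂|) :
    ∀ x₀ y₀ : ℝ, (x₀, y₀) ∈ G₀ ∪ Ghat₀ →
      ∀ (I₁ I₂ : Set ℝ) (φ₁ φ₂ : ℝ → ℝ),
        I₁.OrdConnected → x₀ ∈ I₁ → I₂.OrdConnected → x₀ ∈ I₂ →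
        φ₁ x₀ = y₀ → φ₂ x₀ = y₀ →
        IsSolOn f (G ∪ Ghat) φ₁ I₁ → IsSolOn f (G ∪ Ghat) φ₂ I₂ →
        ∃ δ > 0, ∀ x ∈ I₁ ∩ I₂ ∩ Icc (x₀ - δ) (x₀ + δ), φ₁ x = φ₂ x := by
  intro x₀ y₀ hp I₁ I₂ φ₁ φ₂ hI₁ hx₁ hI₂ hx₂ h₁ h₂ hs₁ hs₂
  obtain ⟨c, hc, L, -, hLip⟩ := hLip _ hp
  obtain ⟨d₁, hd₁, hb₁⟩ := (hs₁ x₀ hx₁).2.continuousWithinAt.exists_forall_mem_Icc hc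
  obtain ⟨d₂, hd₂, hb₂⟩ := (hs₂ x₀ hx₂).2.continuousWithinAt.exists_forall_mem_Icc hc
  rw [h₁] at hb₁
  rw [h₂] at hb₂
  obtain ⟨δ, hδ, hδc, hδ₁, hδ₂⟩ : ∃ δ > 0, δ ≤ c ∧ δ ≤ d₁ ∧ δ ≤ d₂ :=
    ⟨min c (min d₁ d₂), by positivity, min_le_left _ _, by simp, by simp⟩
  have hsub : ∀ {d : ℝ}, δ ≤ d → Icc (x₀ - δ) (x₀ + δ) ⊆ Icc (x₀ - d) (x₀ + d) :=
    fun h => Icc_subset_Icc (by linarith) (by linarith)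
  refine ⟨δ, hδ, fun x hx => sub_eq_zero.1 ?_⟩
  refine eq_zero_of_abs_derivWithin_le_ordConnected (g := fun x => φ₁ x - φ₂ x)
    (g' := fun x => f (x, φ₁ x) - f (x, φ₂ x)) (L := L) (a := x₀)
    ((hI₁.inter hI₂).inter ordConnected_Icc)
    ⟨⟨hx₁, hx₂⟩, by constructor <;> linarith⟩ (fun t ht => ?_) (fun t ht => ?_)
    (by simp [h₁, h₂]) x hx
  · exact ((hs₁ t ht.1.1).2.mono fun _ h => h.1.1).sub ((hs₂ t ht.1.2).2.mono fun _ h => h.1.2)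
  · exact hLip t (φ₁ t) (φ₂ t)
      ⟨(hs₁ t ht.1.1).1, hsub hδc ht.2, hb₁ t ht.1.1 (hsub hδ₁ ht.2)⟩
      ⟨(hs₂ t ht.1.2).1, hsub hδc ht.2, hb₂ t ht.1.2 (hsub hδ₂ ht.2)⟩
end

section
/- Theorem on existence of a solution of the boundary initial value problem (case U₁⁺⁼ under condition (4)): Let a > 0 and let b : [0,a] → ℝ be continuously differentiable and convex with b(0) = 0, b'(0) = 0 and b(a) ≤ a. Let K = {(x,y) : 0 ≤ x ≤ a, −a ≤ y ≤ b(x)}, and let f : ℝ² → ℝ be continuous on K with f(0,0) = 0 and f(x, b(x)) ≤ b'(x) for all x ∈ (0, a]. Then there exist h ∈ (0, a] and a function φ : [0,h] → ℝ such that φ(0) = 0, (x, φ(x)) ∈ K for all x ∈ [0,h], φ is differentiable on [0,h] (one-sided at the endpoints), and φ'(x) = f(x, φ(x)) for all x ∈ [0,h]. -/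
open Set

open Filter Topology MeasureTheory intervalIntegral in
theorem exists_subseq_tendsto_of_lipschitzWith {L : NNReal} {u : ℕ → ℝ → ℝ}
    (hu : ∀ n, LipschitzWith L (u n)) (hu0 : ∀ n, u n 0 = 0) {h : ℝ} (hh : 0 ≤ h) :
    ∃ φ : ℝ → ℝ, LipschitzWith L φ ∧ ∃ θ : ℕ → ℕ, StrictMono θ ∧
      ∀ t ∈ Icc 0 h, Tendsto (fun n => u (θ n) t) atTop (𝓝 (φ t)) := by
  let g : ℕ → BoundedContinuousFunction (Icc 0 h) ℝ := fun n =>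
    .mkOfCompact ⟨fun x => u n x, (hu n).continuous.comp continuous_subtype_val⟩
  have hgu (n : ℕ) (x : Icc 0 h) : g n x = u n x := rfl
  have hcompact : IsCompact (closure (range g)) := by
    refine BoundedContinuousFunction.arzela_ascoli (Metric.closedBall 0 (L * h))
      (isCompact_closedBall _ _) _ ?_ (LipschitzWith.uniformEquicontinuous _ L ?_).equicontinuous
    · rintro _ x ⟨n, rfl⟩
      have hx := (hu n).dist_le_mul x 0
      rw [hu0, Real.dist_0_eq_abs, Real.dist_0_eq_abs, abs_of_nonneg x.2.1] at hx
      rw [mem_closedBall_zero_iff, hgu, Real.norm_eq_abs]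
      exact hx.trans (mul_le_mul_of_nonneg_left x.2.2 L.2)
    · rintro ⟨_, n, rfl⟩ x y
      exact hu n x y
  obtain ⟨G, -, θ, hθ, hG⟩ := hcompact.tendsto_subseq fun n => subset_closure (mem_range_self n)
  have hlim (x : Icc 0 h) : Tendsto (fun n => u (θ n) x) atTop (𝓝 (G x)) :=
    ((continuous_eval_const x).tendsto G).comp hG
  have hGL : LipschitzWith L G := LipschitzWith.of_dist_le_mul fun x y =>
    le_of_tendsto ((hlim x).dist (hlim y)) (.of_forall fun n => (hu (θ n)).dist_le_mul x y)
  refine ⟨G ∘ projIcc 0 h hh, ?_, θ, hθ, fun t ht => ?_⟩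
  · simpa using hGL.comp (LipschitzWith.projIcc hh)
  · simpa [projIcc_of_mem hh ht] using hlim ⟨t, ht⟩

theorem lipschitzWith_primitive {g : ℝ → ℝ} (hg : Continuous g) {L : NNReal}
    (hL : ∀ s, |g s| ≤ L) (t₀ : ℝ) : LipschitzWith L fun t => ∫ s in t₀..t, g s := by
  refine LipschitzWith.of_dist_le_mul fun x y => ?_
  rw [Real.dist_eq, Real.dist_eq, intervalIntegral.integral_interval_sub_left
    (hg.intervalIntegrable _ _) (hg.intervalIntegrable _ _)]
  exact intervalIntegral.norm_integral_le_of_norm_le_const fun s _ =>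
    (Real.norm_eq_abs (g s)).trans_le (hL s)

/-- Tonelli's approximate solutions: the integral equation with delay `δ`. -/
theorem exists_delayed_integral_equation {F : ℝ × ℝ → ℝ} (hF : Continuous F) {L : NNReal}
    (hL : ∀ p, |F p| ≤ L) (h : ℝ) {δ : ℝ} (hδ : 0 < δ) :
    ∃ u : ℝ → ℝ, LipschitzWith L u ∧ u 0 = 0 ∧
      ∀ t ∈ Icc 0 h, u t = ∫ s in (0 : ℝ)..t, F (s, u (max (s - δ) 0)) := by
  let T : (ℝ → ℝ) → ℝ → ℝ := fun u t => ∫ s in (0 : ℝ)..t, F (s, u (max (s - δ) 0))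
  have hT0 (u : ℝ → ℝ) : T u 0 = 0 := intervalIntegral.integral_same
  have hTL (u : ℝ → ℝ) (hu : Continuous u) : LipschitzWith L (T u) :=
    lipschitzWith_primitive (by fun_prop) (fun _ => hL _) 0
  let U : ℕ → ℝ → ℝ := fun k => T^[k] 0
  have hUsucc (k : ℕ) : U (k + 1) = T (U k) := Function.iterate_succ_apply' T k 0
  have hU (k : ℕ) : LipschitzWith L (U k) ∧ U k 0 = 0 := by
    induction k with
    | zero => exact ⟨LipschitzWith.const' 0, rfl⟩
    | succ k ih =>
      rw [hUsucc]
      exact ⟨hTL _ ih.1.continuous, hT0 _⟩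
  have hfix (k : ℕ) : ∀ t ∈ Icc 0 (k * δ), U k t = T (U k) t := by
    induction k with
    | zero =>
      rintro t ⟨h0, h1⟩
      obtain rfl : t = 0 := le_antisymm (by simpa using h1) h0
      rw [hT0, (hU 0).2]
    | succ k ih =>
      rintro t ⟨h0, h1⟩
      rw [hUsucc]
      refine intervalIntegral.integral_congr fun s hs => ?_
      rw [uIcc_of_le h0] at hs
      have hsk : max (s - δ) 0 ∈ Icc 0 (k * δ) := by
        refine ⟨le_max_right _ _, max_le ?_ (by positivity)⟩
        push_cast at h1
        linarith [hs.2]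
      simp only [ih _ hsk]
  obtain ⟨N, hN⟩ := exists_nat_ge (h / δ)
  refine ⟨U N, (hU N).1, (hU N).2, fun t ht => hfix N t ⟨ht.1, ht.2.trans ?_⟩⟩
  exact (div_le_iff₀ hδ).1 hN

open Filter Topology in
/-- **Peano's existence theorem** for a bounded continuous scalar field. -/
theorem exists_hasDerivWithinAt_of_continuous_bounded {F : ℝ × ℝ → ℝ} (hF : Continuous F)
    {L : NNReal} (hL : ∀ p, |F p| ≤ L) {h : ℝ} (hh : 0 ≤ h) :
    ∃ φ : ℝ → ℝ, LipschitzWith L φ ∧ φ 0 = 0 ∧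
      ∀ t ∈ Icc 0 h, HasDerivWithinAt φ (F (t, φ t)) (Icc 0 h) t := by
  choose u huL hu0 hu using fun n : ℕ =>
    exists_delayed_integral_equation hF hL h (δ := 1 / ((n : ℝ) + 1)) (by positivity)
  obtain ⟨φ, hφL, θ, hθ, hlim⟩ := exists_subseq_tendsto_of_lipschitzWith huL hu0 hh
  have hφc := hφL.continuous
  have hdelay (s : ℝ) (hs : s ∈ Icc 0 h) :
      Tendsto (fun n => u (θ n) (max (s - 1 / ((θ n : ℝ) + 1)) 0)) atTop (𝓝 (φ s)) := by
    have hδ : Tendsto (fun n => L * (1 / ((θ n : ℝ) + 1))) atTop (𝓝 0) := by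
      simpa using (tendsto_one_div_add_atTop_nhds_zero_nat (𝕜 := ℝ)).comp
        hθ.tendsto_atTop |>.const_mul (L : ℝ)
    refine (hlim s hs).congr_dist (squeeze_zero (fun _ => dist_nonneg) (fun n => ?_) hδ)
    refine ((huL (θ n)).dist_le_mul _ _).trans (mul_le_mul_of_nonneg_left ?_ L.2)
    have hpos : 0 < 1 / ((θ n : ℝ) + 1) := by positivity
    rw [Real.dist_eq, abs_le]
    constructor
    · linarith [max_le (show s - 1 / ((θ n : ℝ) + 1) ≤ s by linarith) hs.1]
    · linarith [le_max_left (s - 1 / ((θ n : ℝ) + 1)) 0]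
  have hint (t : ℝ) (ht : t ∈ Icc 0 h) : φ t = ∫ s in (0 : ℝ)..t, F (s, φ s) := by
    refine tendsto_nhds_unique (hlim t ht) ?_
    simp only [hu _ t ht]
    refine intervalIntegral.tendsto_integral_filter_of_dominated_convergence (fun _ => (L : ℝ))
      (.of_forall fun n => ?_) (.of_forall fun n => .of_forall fun s _ => hL _)
      intervalIntegrable_const (.of_forall fun s hs => ?_)
    · have := (huL (θ n)).continuous
      exact Continuous.aestronglyMeasurable (by fun_prop)
    · rw [uIoc_of_le ht.1] at hs
      exact (hF.tendsto _).comp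
        (tendsto_const_nhds.prodMk_nhds (hdelay s ⟨hs.1.le, hs.2.trans ht.2⟩))
  refine ⟨φ, hφL, by simpa using hint 0 ⟨le_rfl, hh⟩, fun t ht => ?_⟩
  have hc : Continuous fun s => F (s, φ s) := by fun_prop
  exact (hc.integral_hasStrictDerivAt 0 t).hasDerivAt.hasDerivWithinAt.congr_of_mem hint ht

/-- Theorem on existence of a solution of the boundary initial value problem, in
the case `U₁⁺⁼` under condition (4): the initial point `(0,0)` lies on the boundary
of the region `K = {(x,y) : 0 ≤ x ≤ a, −a ≤ y ≤ b(x)}` and the direction field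
points inside or along the upper boundary curve `y = b(x)`. -/
theorem bivp_existence_case_U1
    (a : ℝ) (ha : 0 < a) (b b' : ℝ → ℝ)
    (hbderiv : ∀ x ∈ Icc (0 : ℝ) a, HasDerivWithinAt b (b' x) (Icc (0 : ℝ) a) x)
    (hb'cont : ContinuousOn b' (Icc (0 : ℝ) a))
    (hconv : ConvexOn ℝ (Icc (0 : ℝ) a) b)
    (hb0 : b 0 = 0) (hb'0 : b' 0 = 0) (hba : b a ≤ a)
    (K : Set (ℝ × ℝ))
    (hK : K = {p : ℝ × ℝ | 0 ≤ p.1 ∧ p.1 ≤ a ∧ -a ≤ p.2 ∧ p.2 ≤ b p.1})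
    (f : ℝ × ℝ → ℝ) (hf : ContinuousOn f K) (hf0 : f (0, 0) = 0)
    (hfield : ∀ x ∈ Ioc (0 : ℝ) a, f (x, b x) ≤ b' x) :
    ∃ h : ℝ, 0 < h ∧ h ≤ a ∧ ∃ φ : ℝ → ℝ, φ 0 = 0 ∧
      ∀ x ∈ Icc (0 : ℝ) h,
        (x, φ x) ∈ K ∧ HasDerivWithinAt φ (f (x, φ x)) (Icc (0 : ℝ) h) x := by
  have h0a : (0 : ℝ) ∈ Icc 0 a := ⟨le_rfl, ha.le⟩
  have hbcont : ContinuousOn b (Icc 0 a) := fun x hx => (hbderiv x hx).continuousWithinAt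
  have hbnonneg : ∀ x ∈ Icc (0 : ℝ) a, 0 ≤ b x := by
    intro x hx
    rcases hx.1.eq_or_lt with rfl | hpos
    · exact hb0.ge
    · have hslope := hconv.le_slope_of_hasDerivWithinAt h0a hx hpos (hbderiv 0 h0a)
      rw [hb'0, slope_def_field, hb0, sub_zero, sub_zero] at hslope
      simpa [hpos.ne'] using mul_nonneg hslope hpos.le
  let c : ℝ → ℝ := fun x => max 0 (min x a)
  have hc : Continuous c := by fun_prop
  have hcmem (x : ℝ) : c x ∈ Icc 0 a := ⟨le_max_left _ _, max_le ha.le (min_le_right _ _)⟩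
  have hcid {x : ℝ} (hx : x ∈ Icc 0 a) : c x = x := by simp [c, hx.1, hx.2]
  have hB : Continuous fun x => b (c x) := hbcont.comp_continuous hc hcmem
  have hKcompact : IsCompact K := by
    have hKeq : K = (Icc 0 a ×ˢ Icc (-a) a) ∩ {p : ℝ × ℝ | p.2 ≤ b (c p.1)} := by
      ext ⟨x, y⟩
      simp only [hK, mem_ofPred_eq, mem_inter_iff, mem_prod, mem_Icc]
      constructor
      · rintro ⟨h1, h2, h3, h4⟩
        have hle := hconv.le_max_of_mem_Icc h0a ⟨ha.le, le_rfl⟩ ⟨h1, h2⟩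
        rw [hcid ⟨h1, h2⟩]
        exact ⟨⟨⟨h1, h2⟩, h3, h4.trans (hle.trans (max_le (hb0.le.trans ha.le) hba))⟩, h4⟩
      · rintro ⟨⟨⟨h1, h2⟩, h3, -⟩, h4⟩
        rw [hcid ⟨h1, h2⟩] at h4
        exact ⟨h1, h2, h3, h4⟩
    rw [hKeq]
    exact (isCompact_Icc.prod isCompact_Icc).inter_right
      (isClosed_le continuous_snd (hB.comp continuous_fst))
  obtain ⟨M, hM⟩ := hKcompact.exists_bound_of_continuousOn hf
  let r : ℝ × ℝ → ℝ × ℝ := fun p => (c p.1, max (-a) (min p.2 (b (c p.1))))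
  have hr : Continuous r := (hc.comp continuous_fst).prodMk
    (continuous_const.max (continuous_snd.min (hB.comp continuous_fst)))
  have hrK (p : ℝ × ℝ) : r p ∈ K := by
    rw [hK]
    refine ⟨(hcmem _).1, (hcmem _).2, le_max_left _ _, max_le ?_ (min_le_right _ _)⟩
    linarith [hbnonneg _ (hcmem p.1)]
  let L : NNReal := ⟨max M 1, by positivity⟩
  have hL1 : (1 : ℝ) ≤ L := le_max_right _ _
  have hLpos : (0 : ℝ) < L := by linarith
  have hha : a / L ≤ a := div_le_self ha.le hL1
  have hhpos : 0 < a / L := by positivity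
  have hsub : Icc 0 (a / L) ⊆ Icc 0 a := Icc_subset_Icc_right hha
  obtain ⟨φ, hφL, hφ0, hφ⟩ := exists_hasDerivWithinAt_of_continuous_bounded
    (hf.comp_continuous hr hrK) (L := L) (fun p => (hM _ (hrK p)).trans (le_max_left _ _)) hhpos.le
  have hlower : ∀ x ∈ Icc 0 (a / L), -a ≤ φ x := by
    intro x hx
    have hdist := hφL.dist_le_mul x 0
    rw [hφ0, Real.dist_0_eq_abs, Real.dist_0_eq_abs, abs_of_nonneg hx.1] at hdist
    have hxL := (le_div_iff₀ hLpos).1 hx.2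
    linarith [neg_abs_le (φ x)]
  have hright {g : ℝ → ℝ} {g' d x : ℝ} (hg : HasDerivWithinAt g g' (Icc 0 d) x)
      (hx : x ∈ Ico 0 d) : HasDerivWithinAt g g' (Ici x) x :=
    hg.mono_of_mem_nhdsWithin (Filter.mem_of_superset (Icc_mem_nhdsGE hx.2)
      (Icc_subset_Icc_left hx.1))
  have hupper_add (ε : ℝ) (hε : 0 < ε) : ∀ x ∈ Icc 0 (a / L), φ x ≤ b x + ε * x := by
    refine image_le_of_deriv_right_lt_deriv_boundary' hφL.continuous.continuousOn
      (fun x hx => hright (hφ x (Ico_subset_Icc_self hx)) hx) (by simp [hφ0, hb0])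
      ((hbcont.mono hsub).add (by fun_prop))
      (fun x hx => (hright (hbderiv x (hsub (Ico_subset_Icc_self hx)))
        ⟨hx.1, hx.2.trans_le hha⟩).add ((hasDerivAt_id x).const_mul ε).hasDerivWithinAt) ?_
    intro x hx hxe
    have hxa := hsub (Ico_subset_Icc_self hx)
    have hrx : r (x, φ x) = (x, b x) := by
      have h1 : b x ≤ φ x := by rw [hxe]; linarith [mul_nonneg hε.le hx.1]
      have h2 : -a ≤ b x := by linarith [hbnonneg x hxa]
      simp [r, hcid hxa, h1, h2]
    have hfb : f (x, b x) ≤ b' x := by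
      rcases hx.1.eq_or_lt with rfl | hpos
      · rw [hb0, hf0, hb'0]
      · exact hfield x ⟨hpos, hxa.2⟩
    simp only [Function.comp_apply, hrx]
    linarith
  have hupper : ∀ x ∈ Icc 0 (a / L), φ x ≤ b x := by
    intro x hx
    refine le_of_forall_pos_le_add fun ε hε => ?_
    have hle := hupper_add (ε / a) (by positivity) x hx
    have : ε / a * x ≤ ε / a * a := mul_le_mul_of_nonneg_left (hsub hx).2 (by positivity)
    rw [div_mul_cancel₀ _ ha.ne'] at this
    linarith
  refine ⟨a / L, hhpos, hha, φ, hφ0, fun x hx => ⟨?_, ?_⟩⟩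
  · rw [hK]
    exact ⟨hx.1, (hsub hx).2, hlower x hx, hupper x hx⟩
  · have hrx : r (x, φ x) = (x, φ x) := by
      simp [r, hcid (hsub hx), hupper x hx, hlower x hx]
    simpa only [Function.comp_apply, hrx] using hφ x hx
end

section
/- Theorem on local uniqueness of the solution of the boundary initial value problem (case U₁⁺⁼ under condition (4)): Let a > 0, let b : [0,a] → ℝ be continuously differentiable and convex with b(0) = 0, b'(0) = 0 and b(a) ≤ a, let K = {(x,y) : 0 ≤ x ≤ a, −a ≤ y ≤ b(x)}, and let f : ℝ² → ℝ be continuous on K with f(0,0) = 0 and f(x, b(x)) ≤ b'(x) for all x ∈ (0,a]. Assume (0,0) is a formal uniqueness point: for any two solutions φ₁, φ₂ of the initial value problem IVP(0,0) of y' = f(x,y) with graphs in K, defined on intervals [0,b₁⟩ and [0,b₂⟩, there exists β > 0 with φ₁(x) = φ₂(x) for all x ∈ [0,β) ∩ [0,b₁⟩ ∩ [0,b₂⟩. Then the solution of the boundary initial value problem at (0,0) is right locally unique: there exists h > 0 such that every solution of IVP(0,0) with graph in K extends to a solution on [0,h] with graph in K, and any two solutions of IVP(0,0) defined on [0,h]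 with graphs in K coincide on [0,h]. -/
open Set

open Filter Topology NNReal

/-- A bounded uniformly continuous function is approximated from above by Lipschitz functions,
with a gap bounded below and above. -/
theorem UniformContinuous.exists_lipschitzWith_between {X : Type*} [PseudoMetricSpace X]
    {F : X → ℝ} (hF : UniformContinuous F) {M : ℝ} (hM : ∀ p, |F p| ≤ M) {ε : ℝ} (hε : 0 < ε) :
    ∃ (L : ℝ≥0) (G : X → ℝ), LipschitzWith L G ∧ ∀ p, F p + ε ≤ G p ∧ G p ≤ F p + 2 * ε := by
  obtain ⟨δ, hδ, hFδ⟩ := Metric.uniformContinuous_iff.1 hF ε hε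
  have hbdd (L : ℝ≥0) (p : X) : BddAbove (range fun q => F q - L * dist p q) := by
    refine ⟨M, ?_⟩
    rintro _ ⟨q, rfl⟩
    have h1 := (abs_le.1 (hM q)).2
    have h2 : 0 ≤ (L : ℝ) * dist p q := by positivity
    simp only
    linarith
  set L : ℝ≥0 := ⟨2 * |M| / δ, by positivity⟩
  have hL : (L : ℝ) = 2 * |M| / δ := rfl
  refine ⟨L, fun p => ε + ⨆ q, (F q - L * dist p q), ?_, fun p => ⟨?_, ?_⟩⟩
  · refine LipschitzWith.of_le_add_mul L fun p p' => ?_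
    have : Nonempty X := ⟨p⟩
    rw [add_assoc]
    refine add_le_add le_rfl (ciSup_le fun q => ?_)
    have h1 := le_ciSup (hbdd L p') q
    have h2 : (L : ℝ) * dist p' q ≤ L * (dist p p' + dist p q) := by
      rw [dist_comm p p']
      exact mul_le_mul_of_nonneg_left (dist_triangle _ _ _) L.2
    linarith
  · have h1 := le_ciSup (hbdd L p) p
    simp only [dist_self, mul_zero, sub_zero] at h1
    linarith
  · have : Nonempty X := ⟨p⟩
    have : ⨆ q, (F q - L * dist p q) ≤ F p + ε := by
      refine ciSup_le fun q => ?_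
      rcases lt_or_ge (dist p q) δ with h | h
      · have h1 := (abs_lt.1 (Real.dist_eq (F p) (F q) ▸ hFδ h)).1
        have h2 : 0 ≤ (L : ℝ) * dist p q := by positivity
        linarith
      · have h1 : 2 * |M| ≤ L * dist p q := by
          rw [hL, div_mul_eq_mul_div, le_div_iff₀ hδ]
          gcongr
        have h2 := abs_le.1 (hM p)
        have h3 := abs_le.1 (hM q)
        have h4 := le_abs_self M
        linarith
    linarith

/-- Restricting a one-sided derivative to the right half-line. -/
theorem HasDerivWithinAt.Ici_of_Icc {φ : ℝ → ℝ} {φ' c d x : ℝ}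
    (h : HasDerivWithinAt φ φ' (Icc c d) x) (hx : x ∈ Ico c d) :
    HasDerivWithinAt φ φ' (Ici x) x :=
  h.mono_of_mem_nhdsWithin (Icc_mem_nhdsGE_of_mem hx)

/-- Comparison of solutions for strictly ordered right-hand sides. -/
theorem solution_le_of_field_lt {F G : ℝ × ℝ → ℝ} (hFG : ∀ p, F p < G p) {c : ℝ} {φ ψ : ℝ → ℝ}
    (h0 : φ 0 = ψ 0)
    (hφ : ∀ x ∈ Icc 0 c, HasDerivWithinAt φ (F (x, φ x)) (Icc 0 c) x)
    (hψ : ∀ x ∈ Icc 0 c, HasDerivWithinAt ψ (G (x, ψ x)) (Icc 0 c) x) :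
    ∀ x ∈ Icc 0 c, φ x ≤ ψ x := by
  have h := image_le_of_deriv_right_lt_deriv_boundary' (f := φ) (B := ψ)
    (f' := fun x => F (x, φ x)) (B' := fun x => G (x, ψ x))
    (fun x hx => (hφ x hx).continuousWithinAt)
    (fun x hx => (hφ x (Ico_subset_Icc_self hx)).Ici_of_Icc hx) h0.le
    (fun x hx => (hψ x hx).continuousWithinAt)
    (fun x hx => (hψ x (Ico_subset_Icc_self hx)).Ici_of_Icc hx)
    (fun x _ hx => by simpa only [hx] using hFG _)
  exact fun x hx => h hx

/-- Global existence for a bounded Lipschitz right-hand side. -/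
theorem LipschitzWith.exists_solution {G : ℝ × ℝ → ℝ} {L : ℝ≥0} (hG : LipschitzWith L G) {M : ℝ}
    (hM : ∀ p, |G p| ≤ M) {h : ℝ} (hh : 0 ≤ h) :
    ∃ φ : ℝ → ℝ, φ 0 = 0 ∧
      ∀ x ∈ Icc 0 h, HasDerivWithinAt φ (G (x, φ x)) (Icc 0 h) x := by
  have hM0 : 0 ≤ M := (abs_nonneg _).trans (hM 0)
  have hpl : IsPicardLindelof (fun x y => G (x, y)) (⟨0, le_rfl, hh⟩ : Icc 0 h) 0
      ⟨M * h, by positivity⟩ 0 ⟨M, hM0⟩ L :=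
    { lipschitzOnWith := fun t _ => by
        refine LipschitzWith.lipschitzOnWith (LipschitzWith.of_dist_le_mul fun y z => ?_)
        simpa [Prod.dist_eq] using hG.dist_le_mul (t, y) (t, z)
      continuousOn := fun y _ => (hG.continuous.comp (by fun_prop)).continuousOn
      norm_le := fun t _ y _ => hM _
      mul_max_le := by
        rw [sub_zero, sub_self, max_eq_left hh, NNReal.coe_zero, sub_zero]
        exact le_rfl }
  exact hpl.exists_eq_forall_mem_Icc_hasDerivWithinAt₀

/-- Existence of a maximal solution for a bounded uniformly continuous right-hand side. -/
theorem UniformContinuous.exists_maximal_solution {F : ℝ × ℝ → ℝ} (hF : UniformContinuous F)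
    {M : ℝ} (hM : ∀ p, |F p| ≤ M) {h : ℝ} (hh : 0 ≤ h) :
    ∃ φ : ℝ → ℝ, φ 0 = 0 ∧
      (∀ x ∈ Icc 0 h, HasDerivWithinAt φ (F (x, φ x)) (Icc 0 h) x) ∧
      ∀ c ∈ Icc 0 h, ∀ ψ : ℝ → ℝ, ψ 0 = 0 →
        (∀ x ∈ Icc 0 c, HasDerivWithinAt ψ (F (x, ψ x)) (Icc 0 c) x) →
        ∀ x ∈ Icc 0 c, ψ x ≤ φ x := by
  have hM0 : 0 ≤ M := (abs_nonneg _).trans (hM 0)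
  have hε (n : ℕ) : (0 : ℝ) < (1 / 3) ^ n := by positivity
  have hε1 (n : ℕ) : ((1 : ℝ) / 3) ^ n ≤ 1 := pow_le_one₀ (by norm_num) (by norm_num)
  have hε0 : Tendsto (fun n : ℕ => ((1 : ℝ) / 3) ^ n) atTop (𝓝 0) :=
    tendsto_pow_atTop_nhds_zero_of_lt_one (by norm_num) (by norm_num)
  choose L G hLip hG using fun n => hF.exists_lipschitzWith_between hM (hε n)
  have hGM (n : ℕ) (p : ℝ × ℝ) : |G n p| ≤ M + 2 := by
    have h1 := hG n p
    have h2 := abs_le.1 (hM p)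
    have h3 := hε n
    have h4 := hε1 n
    exact abs_le.2 ⟨by linarith, by linarith⟩
  choose u hu0 hu using fun n => (hLip n).exists_solution (hGM n) hh
  have hanti (n : ℕ) (x : ℝ) (hx : x ∈ Icc 0 h) : u (n + 1) x ≤ u n x := by
    refine solution_le_of_field_lt (fun p => ?_) (by rw [hu0, hu0]) (hu (n + 1)) (hu n) x hx
    have h1 := (hG (n + 1) p).2
    have h2 := (hG n p).1
    have h3 := hε n
    rw [pow_succ] at h1
    linarith
  have hlipu (n : ℕ) (x : ℝ) (hx : x ∈ Icc 0 h) (y : ℝ) (hy : y ∈ Icc 0 h) :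
      |u n x - u n y| ≤ (M + 2) * |x - y| :=
    (convex_Icc 0 h).norm_image_sub_le_of_norm_hasDerivWithin_le (hu n)
      (fun z _ => hGM n _) hy hx
  have hlim (x : ℝ) : ∃ l, x ∈ Icc 0 h → Tendsto (fun n => u n x) atTop (𝓝 l) := by
    by_cases hx : x ∈ Icc 0 h
    · refine ⟨_, fun _ => tendsto_atTop_ciInf (antitone_nat_of_succ_le fun n => hanti n x hx)
        ⟨-((M + 2) * |x - 0|), ?_⟩⟩
      rintro _ ⟨n, rfl⟩
      have := (abs_le.1 (hlipu n x hx 0 ⟨le_rfl, hh⟩)).1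
      rw [hu0] at this
      simpa using this
    · exact ⟨0, fun h => absurd h hx⟩
  choose φ hφ using hlim
  have hφ0 : φ 0 = 0 := by
    have := hφ 0 ⟨le_rfl, hh⟩
    simp only [hu0] at this
    exact tendsto_nhds_unique this tendsto_const_nhds
  have hφcont : ContinuousOn φ (Icc 0 h) := by
    refine LipschitzOnWith.continuousOn (K := ⟨M + 2, by positivity⟩)
      (LipschitzOnWith.of_dist_le_mul fun x hx y hy => ?_)
    exact le_of_tendsto (((hφ x hx).sub (hφ y hy)).abs)
      (Eventually.of_forall fun n => hlipu n x hx y hy)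
  have hint (t : ℝ) (ht : t ∈ Icc 0 h) :
      φ t = ODE.picard (fun x y => F (x, y)) 0 0 φ t := by
    have hsub : uIcc 0 t ⊆ Icc 0 h := uIcc_subset_Icc ⟨le_rfl, hh⟩ ht
    have hun (n : ℕ) : u n t = ∫ x in (0 : ℝ)..t, G n (x, u n x) := by
      have := ODE.picard_eq_of_hasDerivAt (f := fun x y => G n (x, y)) (α := u n) (t₀ := 0)
        (t := t) (u := univ) ((hLip n).continuous.continuousOn)
        (fun x hx => (hu n x (hsub hx)).mono hsub) (mapsTo_univ _ _)
      rw [← this, ODE.picard_apply, hu0, zero_add]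
    rw [ODE.picard_apply, zero_add]
    refine tendsto_nhds_unique (hφ t ht) ?_
    simp only [hun]
    refine intervalIntegral.tendsto_integral_filter_of_dominated_convergence (fun _ => M + 2)
      (Eventually.of_forall fun n => ?_)
      (Eventually.of_forall fun n => Eventually.of_forall fun x _ => hGM n _)
      (by simp) (Eventually.of_forall fun x hx => ?_)
    · refine ContinuousOn.aestronglyMeasurable ?_ measurableSet_uIoc
      refine (hLip n).continuous.comp_continuousOn (continuousOn_id.prodMk ?_)
      exact fun x hx =>
        (hu n x (hsub (uIoc_subset_uIcc hx))).continuousWithinAt.mono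
          (uIoc_subset_uIcc.trans hsub)
    · have hx' := hsub (uIoc_subset_uIcc hx)
      have h1 : Tendsto (fun n => F (x, u n x)) atTop (𝓝 (F (x, φ x))) :=
        (hF.continuous.tendsto _).comp (tendsto_const_nhds.prodMk_nhds (hφ x hx'))
      have h2 := h1.add (hε0.const_mul 2)
      rw [mul_zero, add_zero] at h2
      exact tendsto_of_tendsto_of_tendsto_of_le_of_le h1 h2
        (fun n => by have := (hG n (x, u n x)).1; have := hε n; simp only; linarith)
        (fun n => (hG n (x, u n x)).2)
  refine ⟨φ, hφ0, fun x hx => ?_, fun c hc ψ hψ0 hψ x hx => ?_⟩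
  · exact (ODE.hasDerivWithinAt_picard_Icc (f := fun x y => F (x, y)) (u := univ) ⟨le_rfl, hh⟩
      hF.continuous.continuousOn hφcont (fun _ _ => mem_univ _) 0 hx).congr_of_mem hint hx
  · have hcsub : Icc 0 c ⊆ Icc 0 h := Icc_subset_Icc_right hc.2
    refine ge_of_tendsto (hφ x (hcsub hx)) (Eventually.of_forall fun n => ?_)
    refine solution_le_of_field_lt (fun p => ?_) (by rw [hψ0, hu0]) hψ
      (fun y hy => (hu n y (hcsub hy)).mono hcsub) x hx
    have h1 := (hG n p).1
    have h2 := hε n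
    linarith

/-- Existence of a minimal solution for a bounded uniformly continuous right-hand side. -/
theorem UniformContinuous.exists_minimal_solution {F : ℝ × ℝ → ℝ} (hF : UniformContinuous F)
    {M : ℝ} (hM : ∀ p, |F p| ≤ M) {h : ℝ} (hh : 0 ≤ h) :
    ∃ φ : ℝ → ℝ, φ 0 = 0 ∧
      (∀ x ∈ Icc 0 h, HasDerivWithinAt φ (F (x, φ x)) (Icc 0 h) x) ∧
      ∀ c ∈ Icc 0 h, ∀ ψ : ℝ → ℝ, ψ 0 = 0 →
        (∀ x ∈ Icc 0 c, HasDerivWithinAt ψ (F (x, ψ x)) (Icc 0 c) x) →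
        ∀ x ∈ Icc 0 c, φ x ≤ ψ x := by
  have hF' : UniformContinuous fun p : ℝ × ℝ => -F (p.1, -p.2) :=
    (hF.comp (uniformContinuous_fst.prodMk uniformContinuous_snd.neg)).neg
  obtain ⟨φ, hφ0, hφ, hmax⟩ :=
    hF'.exists_maximal_solution (M := M) (fun p => by simpa using hM _) hh
  refine ⟨fun x => -φ x, by simp [hφ0], fun x hx => by simpa using (hφ x hx).fun_neg,
    fun c hc ψ hψ0 hψ x hx => ?_⟩
  have := hmax c hc (fun x => -ψ x) (by simp [hψ0])
    (fun y hy => by simpa using (hψ y hy).fun_neg) x hx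
  linarith

/-- Extending the right-hand side `f` from the region `-a ≤ y ≤ b x` over `[0, a]` to the whole
plane, keeping the values `f (x, b x)` above the graph of `b`. -/
theorem exists_extension_under_graph {a : ℝ} (ha : 0 < a) {b : ℝ → ℝ}
    (hb : ContinuousOn b (Icc 0 a)) (hb0 : ∀ x ∈ Icc 0 a, -a ≤ b x)
    {f : ℝ × ℝ → ℝ}
    (hf : ContinuousOn f {p : ℝ × ℝ | 0 ≤ p.1 ∧ p.1 ≤ a ∧ -a ≤ p.2 ∧ p.2 ≤ b p.1}) :
    ∃ F : ℝ × ℝ → ℝ, UniformContinuous F ∧ (∃ M, ∀ p, |F p| ≤ M) ∧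
      ∀ x ∈ Icc 0 a, ∀ y ∈ Icc (-a) a, F (x, y) = f (x, min y (b x)) := by
  have haa : -a ≤ a := by linarith
  let F₀ : Icc (0 : ℝ) a × Icc (-a) a → ℝ := fun p => f (p.1, min p.2 (b p.1))
  have hF₀ : Continuous F₀ := by
    have hb' : Continuous fun p : Icc (0 : ℝ) a × Icc (-a) a => b p.1 :=
      hb.domRestrict.comp continuous_fst
    refine hf.comp_continuous 
      (by exact Continuous.prodMk (by fun_prop) (Continuous.min (by fun_prop) hb')) fun p => ?_
    exact ⟨p.1.2.1, p.1.2.2, le_min p.2.2.1 (hb0 _ p.1.2), min_le_right _ _⟩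
  refine ⟨fun p => F₀ (projIcc 0 a ha.le p.1, projIcc (-a) a haa p.2), ?_, ?_, ?_⟩
  · exact (CompactSpace.uniformContinuous_of_continuous hF₀).comp
      (((LipschitzWith.projIcc ha.le).uniformContinuous.comp uniformContinuous_fst).prodMk
        ((LipschitzWith.projIcc haa).uniformContinuous.comp uniformContinuous_snd))
  · obtain ⟨M, hM⟩ := isCompact_univ.exists_bound_of_continuousOn hF₀.continuousOn
    exact ⟨M, fun p => hM _ (mem_univ _)⟩
  · intro x hx y hy
    simp only [F₀, projIcc_of_mem ha.le hx, projIcc_of_mem haa hy]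

/-- A solution starting at height `b 0` stays below `b`, provided the field crosses the graph of
`b` downwards above it. -/
theorem solution_le_of_field_le_above {F : ℝ × ℝ → ℝ} {b b' ψ : ℝ → ℝ} {c : ℝ}
    (h0 : ψ 0 ≤ b 0)
    (hψ : ∀ x ∈ Icc 0 c, HasDerivWithinAt ψ (F (x, ψ x)) (Icc 0 c) x)
    (hb : ∀ x ∈ Icc 0 c, HasDerivWithinAt b (b' x) (Icc 0 c) x)
    (hF : ∀ x ∈ Icc 0 c, b x < ψ x → F (x, ψ x) ≤ b' x) :
    ∀ x ∈ Icc 0 c, ψ x ≤ b x := by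
  intro x hx
  refine le_of_forall_pos_le_add fun ε hε => ?_
  have hx1 : 0 < 1 + x := by linarith [hx.1]
  set δ := ε / (1 + x)
  have hδ : 0 < δ := div_pos hε hx1
  have hB (y : ℝ) (hy : y ∈ Icc 0 c) :
      HasDerivWithinAt (fun y => b y + δ * (1 + y)) (b' y + δ) (Icc 0 c) y := by
    simpa using (hb y hy).fun_add
      (((hasDerivWithinAt_id y (Icc 0 c)).const_add 1).const_mul δ)
  have h := image_le_of_deriv_right_lt_deriv_boundary' (f := ψ)
    (B := fun y => b y + δ * (1 + y)) (f' := fun x => F (x, ψ x)) (B' := fun y => b' y + δ)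
    (fun y hy => (hψ y hy).continuousWithinAt)
    (fun y hy => (hψ y (Ico_subset_Icc_self hy)).Ici_of_Icc hy)
    (by linarith)
    (fun y hy => (hB y hy).continuousWithinAt)
    (fun y hy => (hB y (Ico_subset_Icc_self hy)).Ici_of_Icc hy)
    (fun y hy hy' => by
      have h1 : 0 < δ * (1 + y) := mul_pos hδ (by linarith [hy.1])
      have h2 := hF y (Ico_subset_Icc_self hy) (by linarith)
      linarith) hx
  have : δ * (1 + x) = ε := div_mul_cancel₀ ε hx1.ne'
  simpa only [this] using h

/-- Theorem on local uniqueness of the solution of the boundary initial value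
problem, case `U₁⁺⁼` under condition (4): if `(0,0)` is a formal uniqueness point,
then the solution of BIVP(0,0) is right locally unique: there is `h > 0` such that
every solution extends to `[0, h]` and any two solutions on `[0, h]` coincide. -/
theorem bivp_local_uniqueness_case_U1
    (a : ℝ) (ha : 0 < a) (b b' : ℝ → ℝ)
    (hbderiv : ∀ x ∈ Icc (0 : ℝ) a, HasDerivWithinAt b (b' x) (Icc (0 : ℝ) a) x)
    (hb'cont : ContinuousOn b' (Icc (0 : ℝ) a))
    (hconv : ConvexOn ℝ (Icc (0 : ℝ) a) b)
    (hb0 : b 0 = 0) (hb'0 : b' 0 = 0) (hba : b a ≤ a)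
    (K : Set (ℝ × ℝ))
    (hK : K = {p : ℝ × ℝ | 0 ≤ p.1 ∧ p.1 ≤ a ∧ -a ≤ p.2 ∧ p.2 ≤ b p.1})
    (f : ℝ × ℝ → ℝ) (hf : ContinuousOn f K) (hf0 : f (0, 0) = 0)
    (hfield : ∀ x ∈ Ioc (0 : ℝ) a, f (x, b x) ≤ b' x)
    (hformal : ∀ (I₁ I₂ : Set ℝ) (φ₁ φ₂ : ℝ → ℝ),
      I₁.OrdConnected → (0 : ℝ) ∈ I₁ → I₁ ⊆ Ici (0 : ℝ) →
      I₂.OrdConnected → (0 : ℝ) ∈ I₂ → I₂ ⊆ Ici (0 : ℝ) →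
      φ₁ 0 = 0 → φ₂ 0 = 0 → IsSolOn f K φ₁ I₁ → IsSolOn f K φ₂ I₂ →
      ∃ β > 0, ∀ x ∈ Ico (0 : ℝ) β ∩ I₁ ∩ I₂, φ₁ x = φ₂ x) :
    ∃ h > 0, (∀ (I : Set ℝ) (φ : ℝ → ℝ),
        I.OrdConnected → (0 : ℝ) ∈ I → I ⊆ Ici (0 : ℝ) →
        φ 0 = 0 → IsSolOn f K φ I →
        ∃ Φ : ℝ → ℝ, Φ 0 = 0 ∧ IsSolOn f K Φ (Icc (0 : ℝ) h) ∧
          ∀ x ∈ I ∩ Icc (0 : ℝ) h, Φ x = φ x) ∧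
      ∀ φ₁ φ₂ : ℝ → ℝ, φ₁ 0 = 0 → φ₂ 0 = 0 →
        IsSolOn f K φ₁ (Icc (0 : ℝ) h) → IsSolOn f K φ₂ (Icc (0 : ℝ) h) →
        ∀ x ∈ Icc (0 : ℝ) h, φ₁ x = φ₂ x := by
  have hb_nonneg : ∀ x ∈ Icc 0 a, 0 ≤ b x := fun x hx => by
    rcases hx.1.eq_or_lt with rfl | h
    · exact hb0.ge
    · have h0 : (0 : ℝ) ∈ Icc 0 a := ⟨le_rfl, ha.le⟩
      have := hconv.le_slope_of_hasDerivWithinAt h0 hx h (hbderiv 0 h0)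
      rw [hb'0, slope_def_field, hb0, sub_zero, sub_zero] at this
      have := mul_nonneg this h.le
      rwa [div_mul_cancel₀ _ h.ne'] at this
  have hb_le : ∀ x ∈ Icc 0 a, b x ≤ a := fun x hx =>
    (hconv.le_max_of_mem_Icc ⟨le_rfl, ha.le⟩ ⟨ha.le, le_rfl⟩ hx).trans
      (max_le (hb0.trans_le ha.le) hba)
  have hb_cont : ContinuousOn b (Icc 0 a) := fun x hx => (hbderiv x hx).continuousWithinAt
  subst hK
  obtain ⟨F, hFuc, ⟨M, hM⟩, hFeq⟩ := exists_extension_under_graph ha hb_cont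
    (fun x hx => by linarith [hb_nonneg x hx]) hf
  have hM0 : 0 ≤ M := (abs_nonneg _).trans (hM 0)
  have hFK (p : ℝ × ℝ) (hp : 0 ≤ p.1 ∧ p.1 ≤ a ∧ -a ≤ p.2 ∧ p.2 ≤ b p.1) : F p = f p := by
    have hx : p.1 ∈ Icc 0 a := ⟨hp.1, hp.2.1⟩
    have := hFeq p.1 hx p.2 ⟨hp.2.2.1, hp.2.2.2.trans (hb_le _ hx)⟩
    rwa [min_eq_left hp.2.2.2] at this
  obtain ⟨h, hh0, hha, hMh⟩ : ∃ h > 0, h ≤ a ∧ M * h ≤ a := by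
    refine ⟨min a (a / (M + 1)), by positivity, min_le_left _ _, ?_⟩
    calc M * min a (a / (M + 1)) ≤ (M + 1) * (a / (M + 1)) := by
          gcongr
          · linarith
          · exact min_le_right _ _
      _ = a := mul_div_cancel₀ a (by positivity)
  have hsol (ψ : ℝ → ℝ) (hψ0 : ψ 0 = 0)
      (hψ : ∀ x ∈ Icc 0 h, HasDerivWithinAt ψ (F (x, ψ x)) (Icc 0 h) x) :
      IsSolOn f {p : ℝ × ℝ | 0 ≤ p.1 ∧ p.1 ≤ a ∧ -a ≤ p.2 ∧ p.2 ≤ b p.1} ψ (Icc 0 h) := by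
    have hsub : Icc 0 h ⊆ Icc 0 a := Icc_subset_Icc_right hha
    have hψa (x : ℝ) (hx : x ∈ Icc 0 h) : ψ x ∈ Icc (-a) a := by
      have h1 := norm_image_sub_le_of_norm_deriv_le_segment' hψ (fun y _ => hM _) x hx
      rw [hψ0, sub_zero, sub_zero, Real.norm_eq_abs] at h1
      exact abs_le.1 (h1.trans ((mul_le_mul_of_nonneg_left hx.2 hM0).trans hMh))
    have hψb : ∀ x ∈ Icc 0 h, ψ x ≤ b x := by
      refine solution_le_of_field_le_above (by rw [hψ0, hb0]) hψ
        (fun x hx => (hbderiv x (hsub hx)).mono hsub) fun x hx hlt => ?_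
      rw [hFeq x (hsub hx) _ (hψa x hx), min_eq_right hlt.le]
      rcases hx.1.eq_or_lt with rfl | hx0
      · rw [hb0, hf0, hb'0]
      · exact hfield x ⟨hx0, (hsub hx).2⟩
    intro x hx
    have hmem := (⟨hx.1, (hsub hx).2, (hψa x hx).1, hψb x hx⟩ :
      0 ≤ (x, ψ x).1 ∧ (x, ψ x).1 ≤ a ∧ -a ≤ (x, ψ x).2 ∧ (x, ψ x).2 ≤ b (x, ψ x).1)
    exact ⟨hmem, hFK _ hmem ▸ hψ x hx⟩
  obtain ⟨u, hu0, hu, hmax⟩ := hFuc.exists_maximal_solution hM hh0.le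
  obtain ⟨l, hl0, hl, hmin⟩ := hFuc.exists_minimal_solution hM hh0.le
  have h0h : (0 : ℝ) ∈ Icc 0 h := ⟨le_rfl, hh0.le⟩
  obtain ⟨β, hβ, hβeq⟩ := hformal _ _ l u ordConnected_Icc h0h Icc_subset_Ici_self
    ordConnected_Icc h0h Icc_subset_Ici_self hl0 hu0 (hsol l hl0 hl) (hsol u hu0 hu)
  have hβh : min h (β / 2) ≤ h := min_le_left _ _
  have heq (I : Set ℝ) (φ : ℝ → ℝ) (hI : I.OrdConnected) (h0 : (0 : ℝ) ∈ I) (hφ0 : φ 0 = 0)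
      (hφ : IsSolOn f {p : ℝ × ℝ | 0 ≤ p.1 ∧ p.1 ≤ a ∧ -a ≤ p.2 ∧ p.2 ≤ b p.1} φ I)
      (x : ℝ) (hxI : x ∈ I) (hx : x ∈ Icc 0 (min h (β / 2))) : φ x = u x := by
    have hsub : Icc 0 x ⊆ I := hI.out h0 hxI
    have hxh : x ∈ Icc 0 h := ⟨hx.1, hx.2.trans hβh⟩
    have hφF : ∀ y ∈ Icc 0 x, HasDerivWithinAt φ (F (y, φ y)) (Icc 0 x) y := fun y hy => by
      rw [hFK _ (hφ y (hsub hy)).1]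
      exact (hφ y (hsub hy)).2.mono hsub
    have hlu := hβeq x ⟨⟨⟨hx.1, by linarith [hx.2.trans (min_le_right h (β / 2))]⟩, hxh⟩, hxh⟩
    have hxx : x ∈ Icc 0 x := ⟨hx.1, le_rfl⟩
    exact le_antisymm (hmax x hxh φ hφ0 hφF x hxx) (hlu ▸ hmin x hxh φ hφ0 hφF x hxx)
  have hsub : Icc 0 (min h (β / 2)) ⊆ Icc 0 h := Icc_subset_Icc_right hβh
  have h0β : (0 : ℝ) ∈ Icc 0 (min h (β / 2)) := ⟨le_rfl, by positivity⟩
  refine ⟨min h (β / 2), by positivity, fun I φ hI h0 _ hφ0 hφ => ⟨u, hu0, fun x hx => ?_,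
    fun x hx => (heq I φ hI h0 hφ0 hφ x hx.1 hx.2).symm⟩, fun φ₁ φ₂ h₁ h₂ hφ₁ hφ₂ x hx => ?_⟩
  · have := hsol u hu0 hu x (hsub hx)
    exact ⟨this.1, this.2.mono hsub⟩
  · rw [heq _ φ₁ ordConnected_Icc h0β h₁ hφ₁ x hx hx, heq _ φ₂ ordConnected_Icc h0β h₂ hφ₂ x hx hx]
end

section
/- Counterexample 1, strip solutions: for each n ∈ ℕ, with b_n = 2^{−2(n+1)}, d_n = 3·2^{−(n+1)} and J_n = [2^{−n}, 2^{−(n−1)}], the function ψ_n(x) = (b_n − (x − d_n)²)^{3/2} is well defined and nonnegative on J_n (i.e., b_n − (x − d_n)² ≥ 0 for x ∈ J_n), satisfies ψ_n(2^{−n}) = ψ_n(2^{−(n−1)}) = 0 and ψ_n(d_n) = 2^{−3(n+1)}, is differentiable on J_n with ψ_n'(x) = −3(x − d_n)·ψ_n(x)^{1/3} for all x ∈ J_n, and |ψ_n'(x)| ≤ 3·2^{−2n−3} for all x ∈ J_n. -/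
open Set Real

theorem rpow_three_halves_rpow_third {a : ℝ} (ha : 0 ≤ a) :
    (a ^ ((3 : ℝ) / 2)) ^ ((1 : ℝ) / 3) = √a := by
  rw [← Real.rpow_mul ha, Real.sqrt_eq_rpow]
  norm_num

theorem sq_rpow_three_halves {h : ℝ} (hh : 0 ≤ h) : (h ^ 2) ^ ((3 : ℝ) / 2) = h ^ 3 := by
  rw [← Real.rpow_natCast_mul hh, ← Real.rpow_natCast]
  norm_num

theorem abs_mul_sqrt_sub_sq_le {b t : ℝ} (ht : t ^ 2 ≤ b) : |t| * √(b - t ^ 2) ≤ b / 2 := by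
  have hs := Real.sq_sqrt (sub_nonneg.2 ht)
  nlinarith [sq_nonneg (|t| - √(b - t ^ 2)), sq_abs t]

theorem hasDerivAt_sub_sq_rpow_three_halves (b d x : ℝ) :
    HasDerivAt (fun x => (b - (x - d) ^ 2) ^ ((3 : ℝ) / 2))
      (-3 * (x - d) * √(b - (x - d) ^ 2)) x := by
  have hf : HasDerivAt (fun x => b - (x - d) ^ 2) (-(2 * (x - d))) x := by
    simpa using (((hasDerivAt_id x).sub_const d).pow 2).const_sub b
  convert hf.rpow_const (p := (3 : ℝ) / 2) (Or.inr (by norm_num)) using 1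
  rw [Real.sqrt_eq_rpow, show (3 : ℝ) / 2 - 1 = 1 / 2 by norm_num]
  ring

/-- Counterexample 1, strip solutions: on each strip `J_n = [2^{-n}, 2^{-(n-1)}]`,
with `b_n = 2^{-2(n+1)}` and midpoint `d_n = 3·2^{-(n+1)}`, the function
`ψ_n(x) = (b_n − (x − d_n)²)^{3/2}` is well defined and nonnegative, vanishes at
the endpoints of `J_n`, equals `2^{-3(n+1)}` at `d_n`, solves
`y' = −3(x − d_n)·y^{1/3}` on `J_n`, and has derivative bounded by `3·2^{-2n-3}`. -/
theorem counterexample1_strip_solutions (n : ℕ) (hn : 1 ≤ n)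
    (bn dn : ℝ) (Jn : Set ℝ) (ψn : ℝ → ℝ)
    (hbn : bn = (2 : ℝ) ^ (-(2 * (n : ℤ) + 2)))
    (hdn : dn = 3 * (2 : ℝ) ^ (-((n : ℤ) + 1)))
    (hJn : Jn = Icc ((2 : ℝ) ^ (-(n : ℤ))) ((2 : ℝ) ^ (-((n : ℤ) - 1))))
    (hψn : ψn = fun x => (bn - (x - dn) ^ 2) ^ ((3 : ℝ) / 2)) :
    (∀ x ∈ Jn, 0 ≤ bn - (x - dn) ^ 2) ∧
    (∀ x ∈ Jn, 0 ≤ ψn x) ∧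
    ψn ((2 : ℝ) ^ (-(n : ℤ))) = 0 ∧
    ψn ((2 : ℝ) ^ (-((n : ℤ) - 1))) = 0 ∧
    ψn dn = (2 : ℝ) ^ (-(3 * (n : ℤ) + 3)) ∧
    (∀ x ∈ Jn,
      HasDerivWithinAt ψn (-3 * (x - dn) * (ψn x) ^ ((1 : ℝ) / 3)) Jn x) ∧
    (∀ x ∈ Jn,
      |(-3) * (x - dn) * (ψn x) ^ ((1 : ℝ) / 3)| ≤ 3 * (2 : ℝ) ^ (-(2 * (n : ℤ) + 3))) := by
  set h : ℝ := (2 : ℝ) ^ (-((n : ℤ) + 1)) with hh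
  have hpos : 0 < h := by positivity
  have two_ne : (2 : ℝ) ≠ 0 := two_ne_zero
  have hleft : (2 : ℝ) ^ (-(n : ℤ)) = 2 * h := by
    rw [hh, ← zpow_one_add₀ two_ne]; congr 1; ring
  have hright : (2 : ℝ) ^ (-((n : ℤ) - 1)) = 4 * h := by
    rw [show (4 : ℝ) = 2 ^ (2 : ℤ) by norm_num, hh, ← zpow_add₀ two_ne]; congr 1; ring
  have hsq : (2 : ℝ) ^ (-(2 * (n : ℤ) + 2)) = h ^ 2 := by
    rw [hh, ← zpow_natCast, ← zpow_mul]; congr 1; push_cast; ring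
  have hcube : (2 : ℝ) ^ (-(3 * (n : ℤ) + 3)) = h ^ 3 := by
    rw [hh, ← zpow_natCast, ← zpow_mul]; congr 1; push_cast; ring
  have hbound : (2 : ℝ) ^ (-(2 * (n : ℤ) + 3)) = h ^ 2 / 2 := by
    rw [← hsq, eq_div_iff two_ne, ← zpow_add_one₀ two_ne]; congr 1
  rw [hsq] at hbn
  rw [hleft, hright] at hJn
  rw [hleft, hright, hcube, hbound]
  have hnonneg : ∀ x ∈ Jn, 0 ≤ bn - (x - dn) ^ 2 := by
    intro x hx
    rw [hJn] at hx
    rw [hbn, hdn]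
    nlinarith [mul_nonneg (sub_nonneg.2 hx.1) (sub_nonneg.2 hx.2)]
  have hroot : ∀ x ∈ Jn, ψn x ^ ((1 : ℝ) / 3) = √(bn - (x - dn) ^ 2) := by
    intro x hx
    rw [hψn]
    exact rpow_three_halves_rpow_third (hnonneg x hx)
  refine ⟨hnonneg, fun x hx => ?_, ?_, ?_, ?_, fun x hx => ?_, fun x hx => ?_⟩
  · rw [hψn]
    exact Real.rpow_nonneg (hnonneg x hx) _
  · simp only [hψn, hbn, hdn]
    rw [show h ^ 2 - (2 * h - 3 * h) ^ 2 = 0 by ring, Real.zero_rpow (by norm_num)]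
  · simp only [hψn, hbn, hdn]
    rw [show h ^ 2 - (4 * h - 3 * h) ^ 2 = 0 by ring, Real.zero_rpow (by norm_num)]
  · simp only [hψn, hbn, sub_self]
    rw [show h ^ 2 - 0 ^ 2 = h ^ 2 by ring, sq_rpow_three_halves hpos.le]
  · rw [hroot x hx, hψn]
    exact (hasDerivAt_sub_sq_rpow_three_halves bn dn x).hasDerivWithinAt
  · rw [hroot x hx, abs_mul, abs_mul, abs_of_nonneg (Real.sqrt_nonneg _), mul_assoc, ← hbn]
    norm_num
    exact abs_mul_sqrt_sub_sq_le (sub_nonneg.1 (hnonneg x hx))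
end

section
/- Counterexample 1, glued solution: with b_n = 2^{−2(n+1)}, d_n = 3·2^{−(n+1)}, J_n = [2^{−n}, 2^{−(n−1)}] and ψ_n(x) = (b_n − (x − d_n)²)^{3/2}, the function ψ : [0,1] → ℝ defined by ψ(0) = 0 and ψ(x) = ψ_n(x) for x ∈ J_n (n ∈ ℕ) is well defined (the values of consecutive pieces agree at the common endpoints 2^{−n}), is continuously differentiable on [0,1] with ψ'(0) = 0, and satisfies ψ(2^{−n}) = 0 and ψ(d_n) = 2^{−3(n+1)} > 0 for every n ∈ ℕ. In particular ψ and the zero function are two distinct functions on [0,1] vanishing together with their derivatives at 0, such that ψ(x_k) ≠ 0 for the sequence x_k = d_k → 0, yet there is no δ > 0 with ψ(x) ≠ 0 for all x ∈ (0,δ). -/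
open Set Filter

lemma rpow_three_halves_eq_mul_sqrt (u : ℝ) : u ^ ((3 : ℝ) / 2) = u * √u := by
  rcases eq_or_ne u 0 with rfl | hu
  · simp [Real.zero_rpow]
  · rw [show (3 : ℝ) / 2 = 1 / 2 + 1 by norm_num, Real.rpow_add_one hu, ← Real.sqrt_eq_rpow,
      mul_comm]

lemma rpow_three_halves_of_nonpos {u : ℝ} (hu : u ≤ 0) : u ^ ((3 : ℝ) / 2) = 0 := by
  rw [rpow_three_halves_eq_mul_sqrt, Real.sqrt_eq_zero_of_nonpos hu, mul_zero]

/-- The bump `(s² - (x - 3s)²)^{3/2}`, supported on `[2s, 4s]`. -/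
noncomputable def bump (s x : ℝ) : ℝ := (s ^ 2 - (x - 3 * s) ^ 2) ^ ((3 : ℝ) / 2)

/-- The derivative of `bump s`. -/
noncomputable def bumpDeriv (s x : ℝ) : ℝ := -3 * (x - 3 * s) * √(s ^ 2 - (x - 3 * s) ^ 2)

lemma hasDerivAt_bump (s x : ℝ) : HasDerivAt (bump s) (bumpDeriv s x) x := by
  have hu : HasDerivAt (fun y : ℝ => s ^ 2 - (y - 3 * s) ^ 2) (-(2 * (x - 3 * s))) x := by
    simpa using (((hasDerivAt_id x).sub_const (3 * s)).pow 2).const_sub (s ^ 2)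
  have h := hu.rpow_const (p := (3 : ℝ) / 2) (Or.inr (by norm_num))
  refine h.congr_deriv ?_
  rw [bumpDeriv, Real.sqrt_eq_rpow, show (3 : ℝ) / 2 - 1 = 1 / 2 by norm_num]
  ring

lemma continuous_bumpDeriv (s : ℝ) : Continuous (bumpDeriv s) := by
  unfold bumpDeriv
  fun_prop

lemma norm_bumpDeriv_le {s : ℝ} (hs : 0 ≤ s) (x : ℝ) : ‖bumpDeriv s x‖ ≤ 3 * s ^ 2 := by
  rcases le_total (s ^ 2 - (x - 3 * s) ^ 2) 0 with hu | hu
  · rw [bumpDeriv, Real.sqrt_eq_zero_of_nonpos hu]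
    simp only [mul_zero, norm_zero]
    positivity
  · have h1 : |x - 3 * s| ≤ s := abs_le_of_sq_le_sq (by linarith) hs
    have h2 : √(s ^ 2 - (x - 3 * s) ^ 2) ≤ s :=
      Real.sqrt_le_iff.2 ⟨hs, by nlinarith [sq_nonneg (x - 3 * s)]⟩
    rw [bumpDeriv, Real.norm_eq_abs, abs_mul, abs_mul, abs_of_nonneg (Real.sqrt_nonneg _)]
    calc |(-3 : ℝ)| * |x - 3 * s| * √(s ^ 2 - (x - 3 * s) ^ 2) ≤ |(-3 : ℝ)| * s * s := by gcongr
      _ = 3 * s ^ 2 := by norm_num; ring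

lemma bump_of_le {s x : ℝ} (hs : 0 ≤ s) (hx : x ≤ 2 * s) : bump s x = 0 :=
  rpow_three_halves_of_nonpos (by nlinarith)

lemma bump_of_ge {s x : ℝ} (hs : 0 ≤ s) (hx : 4 * s ≤ x) : bump s x = 0 :=
  rpow_three_halves_of_nonpos (by nlinarith)

lemma bumpDeriv_zero (s : ℝ) : bumpDeriv s 0 = 0 := by
  rw [bumpDeriv, Real.sqrt_eq_zero_of_nonpos (by nlinarith [sq_nonneg s]), mul_zero]

lemma bump_center {s : ℝ} (hs : 0 ≤ s) : bump s (3 * s) = s ^ 3 := by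
  rw [bump, rpow_three_halves_eq_mul_sqrt, sub_self, zero_pow two_ne_zero, sub_zero,
    Real.sqrt_sq hs]
  ring

lemma tsum_bump_zero : ∑' m : ℕ, bump ((1 / 2) ^ (m + 2)) 0 = 0 := by
  have h (m : ℕ) : bump ((1 / 2) ^ (m + 2)) 0 = 0 := bump_of_le (by positivity) (by positivity)
  simp only [h, tsum_zero]

lemma tsum_bump_eq {n : ℕ} {x : ℝ} (h1 : (1 / 2) ^ (n + 1) ≤ x) (h2 : x ≤ (1 / 2) ^ n) :
    ∑' m : ℕ, bump ((1 / 2) ^ (m + 2)) x = bump ((1 / 2) ^ (n + 2)) x := by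
  refine tsum_eq_single n fun m hm => ?_
  rcases lt_or_gt_of_ne hm with h | h
  · refine bump_of_le (by positivity) (h2.trans ?_)
    have := pow_le_pow_of_le_one (by norm_num : (0 : ℝ) ≤ 1 / 2) (by norm_num)
      (show m + 1 ≤ n from h)
    calc ((1 : ℝ) / 2) ^ n ≤ (1 / 2) ^ (m + 1) := this
      _ = 2 * (1 / 2) ^ (m + 2) := by ring
  · refine bump_of_ge (by positivity) (le_trans ?_ h1)
    have := pow_le_pow_of_le_one (by norm_num : (0 : ℝ) ≤ 1 / 2) (by norm_num)
      (show n + 1 ≤ m from h)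
    calc 4 * ((1 : ℝ) / 2) ^ (m + 2) = (1 / 2) ^ m := by ring
      _ ≤ (1 / 2) ^ (n + 1) := this

lemma summable_bumpDeriv_bound : Summable fun m : ℕ => 3 * (((1 : ℝ) / 2) ^ (m + 2)) ^ 2 := by
  have h := (summable_geometric_of_lt_one (r := (1 : ℝ) / 4) (by norm_num) (by norm_num)).mul_left
    (3 / 16)
  refine h.congr fun m => ?_
  rw [← pow_mul, mul_comm (m + 2), pow_mul]
  norm_num
  ring

lemma hasDerivAt_tsum_bump (x : ℝ) :
    HasDerivAt (fun y => ∑' m : ℕ, bump ((1 / 2) ^ (m + 2)) y)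
      (∑' m : ℕ, bumpDeriv ((1 / 2) ^ (m + 2)) x) x := by
  refine hasDerivAt_tsum summable_bumpDeriv_bound (fun m y => hasDerivAt_bump _ y)
    (fun m y => norm_bumpDeriv_le (by positivity) y) (y₀ := 0) ?_ x
  refine summable_zero.congr fun m => ?_
  exact (bump_of_le (by positivity) (by positivity)).symm

lemma continuous_tsum_bumpDeriv :
    Continuous fun x => ∑' m : ℕ, bumpDeriv ((1 / 2) ^ (m + 2)) x :=
  continuous_tsum (fun _ => continuous_bumpDeriv _) summable_bumpDeriv_bound
    fun _ x => norm_bumpDeriv_le (by positivity) x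

lemma two_zpow_neg_natCast (n : ℕ) : (2 : ℝ) ^ (-(n : ℤ)) = (1 / 2) ^ n := by
  simp

/-- Counterexample 1, glued solution: the function `ψ : [0,1] → ℝ` glued from the
pieces `ψ_n(x) = (b_n − (x − d_n)²)^{3/2}` on `J_n = [2^{-n}, 2^{-(n-1)}]` with
`ψ(0) = 0` is well defined (consecutive pieces agree at the shared endpoints),
continuously differentiable on `[0,1]` with `ψ'(0) = 0`, vanishes at every `2^{-n}`,
is positive at every midpoint `d_n` (where it equals `2^{-3(n+1)}`); thus `ψ` and
the zero function vanish together with their derivatives at `0`, `ψ(d_k) ≠ 0` for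
the sequence `d_k → 0`, yet there is no `δ > 0` with `ψ(x) ≠ 0` on `(0, δ)`. -/
theorem counterexample1_glued_solution
    (bn dn : ℕ → ℝ) (Jn : ℕ → Set ℝ)
    (hbn : ∀ n : ℕ, bn n = (2 : ℝ) ^ (-(2 * (n : ℤ) + 2)))
    (hdn : ∀ n : ℕ, dn n = 3 * (2 : ℝ) ^ (-((n : ℤ) + 1)))
    (hJn : ∀ n : ℕ, Jn n = Icc ((2 : ℝ) ^ (-(n : ℤ))) ((2 : ℝ) ^ (-((n : ℤ) - 1))))
    (ψ : ℝ → ℝ) (hψ0 : ψ 0 = 0)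
    (hψ : ∀ n : ℕ, 1 ≤ n → ∀ x ∈ Jn n, ψ x = (bn n - (x - dn n) ^ 2) ^ ((3 : ℝ) / 2)) :
    -- the pieces agree at the shared endpoints, so ψ is well defined
    (∀ n : ℕ, 1 ≤ n →
      (bn n - ((2 : ℝ) ^ (-(n : ℤ)) - dn n) ^ 2) ^ ((3 : ℝ) / 2) =
      (bn (n + 1) - ((2 : ℝ) ^ (-(n : ℤ)) - dn (n + 1)) ^ 2) ^ ((3 : ℝ) / 2)) ∧
    -- ψ is continuously differentiable on [0,1] with ψ'(0) = 0
    (∃ ψ' : ℝ → ℝ, ContinuousOn ψ' (Icc (0 : ℝ) 1) ∧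
      (∀ x ∈ Icc (0 : ℝ) 1, HasDerivWithinAt ψ (ψ' x) (Icc (0 : ℝ) 1) x) ∧
      ψ' 0 = 0) ∧
    (∀ n : ℕ, 1 ≤ n → ψ ((2 : ℝ) ^ (-(n : ℤ))) = 0) ∧
    (∀ n : ℕ, 1 ≤ n → ψ (dn n) = (2 : ℝ) ^ (-(3 * (n : ℤ) + 3)) ∧ 0 < ψ (dn n)) ∧
    -- ψ ≠ 0 along the sequence d_k → 0,
    Tendsto (fun k => dn k) atTop (nhds 0) ∧
    (∀ n : ℕ, 1 ≤ n → ψ (dn n) ≠ 0) ∧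
    -- yet ψ is not eventually nonzero on any right interval (0, δ)
    (¬ ∃ δ > 0, ∀ x ∈ Ioo (0 : ℝ) δ, ψ x ≠ 0) := by
  have hb (n : ℕ) : bn n = ((1 / 2) ^ (n + 1)) ^ 2 := by
    rw [hbn, ← pow_mul, ← two_zpow_neg_natCast]
    push_cast
    ring_nf
  have hd (n : ℕ) : dn n = 3 * (1 / 2) ^ (n + 1) := by
    rw [hdn, ← two_zpow_neg_natCast]
    push_cast
    rfl
  have hpiece (n : ℕ) (x : ℝ) :
      (bn n - (x - dn n) ^ 2) ^ ((3 : ℝ) / 2) = bump ((1 / 2) ^ (n + 1)) x := by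
    rw [hb, hd, bump]
  have hψs (n : ℕ) (x : ℝ) (h1 : (1 / 2) ^ (n + 1) ≤ x) (h2 : x ≤ (1 / 2) ^ n) :
      ψ x = bump ((1 / 2) ^ (n + 2)) x := by
    rw [hψ (n + 1) (by omega) x, hpiece]
    rw [hJn, two_zpow_neg_natCast, show -(((n + 1 : ℕ) : ℤ) - 1) = -(n : ℤ) by push_cast; ring,
      two_zpow_neg_natCast]
    exact ⟨h1, h2⟩
  have hψsum : ∀ x ∈ Icc (0 : ℝ) 1, ψ x = ∑' m : ℕ, bump ((1 / 2) ^ (m + 2)) x := by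
    rintro x ⟨hx0, hx1⟩
    rcases hx0.eq_or_lt with rfl | hx
    · rw [hψ0, tsum_bump_zero]
    · obtain ⟨n, h1, h2⟩ := exists_nat_pow_near_of_lt_one hx hx1
        (by norm_num : (0 : ℝ) < 1 / 2) (by norm_num)
      rw [hψs n x h1.le h2, tsum_bump_eq h1.le h2]
  have hzero : ∀ n : ℕ, 1 ≤ n → ψ ((2 : ℝ) ^ (-(n : ℤ))) = 0 := by
    intro n hn
    obtain ⟨k, rfl⟩ := Nat.exists_eq_add_of_le' hn
    rw [two_zpow_neg_natCast, hψs k _ le_rfl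
      (pow_le_pow_of_le_one (by norm_num) (by norm_num) k.le_succ)]
    exact bump_of_le (by positivity) (by ring_nf; rfl)
  have hmid : ∀ n : ℕ, 1 ≤ n → ψ (dn n) = (2 : ℝ) ^ (-(3 * (n : ℤ) + 3)) ∧ 0 < ψ (dn n) := by
    intro n hn
    obtain ⟨k, rfl⟩ := Nat.exists_eq_add_of_le' hn
    have hp : (0 : ℝ) < (1 / 2) ^ k := by positivity
    have h1 : ((1 : ℝ) / 2) ^ (k + 1) = (1 / 2) ^ k / 2 := by ring
    have h2 : ((1 : ℝ) / 2) ^ (k + 1 + 1) = (1 / 2) ^ k / 4 := by ring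
    have hval : ψ (dn (k + 1)) = ((1 / 2) ^ (k + 2)) ^ 3 := by
      rw [hd, hψs k, bump_center (by positivity)]
      · linarith
      · linarith
    refine ⟨?_, by rw [hval]; positivity⟩
    rw [hval, ← pow_mul, ← two_zpow_neg_natCast]
    congr 1
    push_cast
    ring
  have htend : Tendsto (fun n : ℕ => ((1 : ℝ) / 2) ^ n) atTop (nhds 0) :=
    tendsto_pow_atTop_nhds_zero_of_lt_one (by norm_num) (by norm_num)
  refine ⟨?_, ⟨fun x => ∑' m : ℕ, bumpDeriv ((1 / 2) ^ (m + 2)) x,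
    continuous_tsum_bumpDeriv.continuousOn, fun x hx => ?_, ?_⟩, hzero, hmid, ?_,
    fun n hn => (hmid n hn).2.ne', ?_⟩
  · intro n _
    rw [hpiece, hpiece, two_zpow_neg_natCast, bump_of_le (by positivity) (by ring_nf; rfl),
      bump_of_ge (by positivity) (by ring_nf; rfl)]
  · exact (hasDerivAt_tsum_bump x).hasDerivWithinAt.congr hψsum (hψsum x hx)
  · simp [bumpDeriv_zero]
  · simp only [hd]
    simpa using ((tendsto_add_atTop_iff_nat 1).2 htend).const_mul 3
  · rintro ⟨δ, hδ, h⟩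
    obtain ⟨n, hn⟩ := exists_pow_lt_of_lt_one hδ (by norm_num : (1 : ℝ) / 2 < 1)
    refine h _ ⟨by positivity, ?_⟩ (hzero (n + 1) (by omega))
    rw [two_zpow_neg_natCast]
    exact (pow_le_pow_of_le_one (by norm_num) (by norm_num) n.le_succ).trans_lt hn
end

section
/- Counterexample 2, properties of the integrand: the function h(v) = 2√(1 − v²) − 2(1 − v²) + (1 − v) satisfies h(v) > 0 for all v ∈ [0,1) and h(1) = 0, and the function v ↦ 2v/h(v) is interval integrable on [0,1] (the improper integral θ = ∫₀¹ 2v/h(v) dv is finite, despite the singularity of the integrand at v = 1). -/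
open Set Real MeasureTheory

/-- The denominator dominates a multiple of `√(1 - v)`, so `1 / h` has an integrable
singularity at `v = 1`. -/
theorem sqrt_one_sub_div_eight_le {v : ℝ} (hv : v ∈ Icc (0 : ℝ) 1) :
    √(1 - v) / 8 ≤ 2 * √(1 - v ^ 2) - 2 * (1 - v ^ 2) + (1 - v) := by
  obtain ⟨h0, h1⟩ := hv
  have hs0 : 0 ≤ √(1 - v ^ 2) := Real.sqrt_nonneg _
  have hs : √(1 - v ^ 2) ^ 2 = 1 - v ^ 2 := Real.sq_sqrt (by nlinarith)
  have hts : √(1 - v) ≤ √(1 - v ^ 2) := Real.sqrt_le_sqrt (by nlinarith)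
  have hs1 : √(1 - v ^ 2) ≤ 1 := Real.sqrt_le_one.mpr (by nlinarith)
  generalize √(1 - v ^ 2) = s at *
  rcases le_total s (1 / 2) with h | h <;> nlinarith [mul_nonneg hs0 (sub_nonneg.mpr hs1)]

/-- Counterexample 2, properties of the integrand: the function
`h(v) = 2√(1 − v²) − 2(1 − v²) + (1 − v)` is positive on `[0,1)`, vanishes at `1`,
and `v ↦ 2v/h(v)` is interval integrable on `[0,1]`, i.e. the improper integral
`θ = ∫₀¹ 2v/h(v) dv` is finite despite the singularity at `v = 1`. -/
theorem counterexample2_integrand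
    (h : ℝ → ℝ)
    (hh : h = fun v => 2 * Real.sqrt (1 - v ^ 2) - 2 * (1 - v ^ 2) + (1 - v)) :
    (∀ v ∈ Ico (0 : ℝ) 1, 0 < h v) ∧
    h 1 = 0 ∧
    IntervalIntegrable (fun v => 2 * v / h v) volume 0 1 := by
  have lower : ∀ v ∈ Icc (0 : ℝ) 1, √(1 - v) / 8 ≤ h v := fun v hv => by
    rw [hh]; exact sqrt_one_sub_div_eight_le hv
  refine ⟨fun v hv => ?_, by simp [hh], ?_⟩
  · have : 0 < √(1 - v) := Real.sqrt_pos.mpr (sub_pos.mpr hv.2)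
    linarith [lower v ⟨hv.1, hv.2.le⟩]
  have hint : IntervalIntegrable (fun v : ℝ => 16 * (1 - v) ^ (-(1 / 2) : ℝ)) volume 0 1 := by
    have := (intervalIntegral.intervalIntegrable_rpow' (a := 1) (b := 0)
      (r := -(1 / 2)) (by norm_num)).comp_sub_left 1
    simpa using this.const_mul 16
  have hmeas : Measurable fun v => 2 * v / h v := by
    rw [hh]; fun_prop
  refine hint.mono_fun' hmeas.aestronglyMeasurable ?_
  rw [uIoc_of_le zero_le_one]
  refine (ae_restrict_mem measurableSet_Ioc).mono fun v hv => ?_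
  have hlow := lower v ⟨hv.1.le, hv.2⟩
  have hnonneg : 0 ≤ h v := le_trans (by positivity) hlow
  have hv0 : 0 ≤ v := hv.1.le
  simp only [Real.norm_eq_abs]
  rw [abs_of_nonneg (by positivity), Real.rpow_neg (sub_nonneg.mpr hv.2), ← Real.sqrt_eq_rpow]
  rcases hv.2.eq_or_lt with rfl | hlt
  · simp [hh]
  · have ht : 0 < √(1 - v) := Real.sqrt_pos.mpr (sub_pos.mpr hlt)
    calc 2 * v / h v ≤ 2 / (√(1 - v) / 8) := by gcongr; linarith
      _ = 16 * (√(1 - v))⁻¹ := by field_simp; norm_num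
end

section
/- Counterexample 2, hidden non-uniqueness at the origin: let θ = ∫₀¹ 2v/h(v) dv with h(v) = 2√(1 − v²) − 2(1 − v²) + (1 − v). For every c > 0 there exists a function φ : [0,c] → ℝ with φ(0) = 0, 0 ≤ φ(x) ≤ x² for all x ∈ [0,c], φ differentiable on [0,c] (one-sided at endpoints) with φ'(x) = √(φ(x)) − 2√(x² − φ(x)) + x for all x ∈ [0,c], such that φ(x) = x² for all x ∈ [0, c·e^{−θ}] and φ(c) = 0. In particular, for every c > 0 the initial value problem at (0,0) for y' = √y − 2√(x² − y) + x has two solutions on [0,c] (namely φ and x ↦ x²) which coincide on [0, c·e^{−θ}] but differ at x = c; hence the solution of this boundary initial value problem is not right locally unique. -/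
open Set Real MeasureTheory intervalIntegral

/-- With `y = x² v²`, the equation `y' = √y − 2√(x² − y) + x` becomes `2 x v v' = -decayRate v`. -/
noncomputable def decayRate (v : ℝ) : ℝ :=
  2 * Real.sqrt (1 - v ^ 2) - 2 * (1 - v ^ 2) + (1 - v)

lemma continuous_decayRate : Continuous decayRate := by
  unfold decayRate
  fun_prop

lemma sqrt_le_decayRate {v : ℝ} (hv : v ∈ Ioo (0 : ℝ) 1) : √(1 - v) / 8 ≤ decayRate v := by
  obtain ⟨h0, h1⟩ := hv
  have hs : √(1 - v ^ 2) ^ 2 = 1 - v ^ 2 := Real.sq_sqrt (by nlinarith)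
  have hle : √(1 - v) ≤ √(1 - v ^ 2) := Real.sqrt_le_sqrt (by nlinarith)
  have hr : √(1 - v) ≤ 1 := Real.sqrt_le_one.mpr (by linarith)
  have hr0 : 0 ≤ √(1 - v) := Real.sqrt_nonneg _
  have hs1 : √(1 - v ^ 2) ≤ 1 := Real.sqrt_le_one.mpr (by nlinarith)
  have hd : decayRate v = 2 * √(1 - v ^ 2) - 2 * √(1 - v ^ 2) ^ 2 + (1 - v) := by
    rw [hs, decayRate]
  rw [hd]
  generalize √(1 - v ^ 2) = s at *
  rcases le_total s (1 / 2) with h | h <;> nlinarith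

lemma decayRate_pos {v : ℝ} (hv : v ∈ Ioo (0 : ℝ) 1) : 0 < decayRate v :=
  lt_of_lt_of_le (div_pos (Real.sqrt_pos.mpr (by linarith [hv.2])) (by norm_num))
    (sqrt_le_decayRate hv)

lemma integrableOn_div_decayRate :
    IntegrableOn (fun v => 2 * v / decayRate v) (Ioo (0 : ℝ) 1) := by
  have hr : IntervalIntegrable (fun v : ℝ => 16 * (1 - v) ^ (-(1 / 2) : ℝ)) volume 0 1 := by
    have := ((intervalIntegrable_rpow' (a := 1) (b := 0) (r := -(1 / 2))
      (by norm_num)).comp_sub_left 1).const_mul 16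
    simpa using this
  rw [intervalIntegrable_iff_integrableOn_Ioo_of_le zero_le_one] at hr
  refine Integrable.mono' hr ?_ ?_
  · have := continuous_decayRate.measurable
    exact Measurable.aestronglyMeasurable (by fun_prop)
  · filter_upwards [ae_restrict_mem measurableSet_Ioo] with v hv
    have hpos := decayRate_pos hv
    have hv1 : 0 < 1 - v := by linarith [hv.2]
    rw [Real.norm_of_nonneg (div_nonneg (by linarith [hv.1]) hpos.le),
      Real.rpow_neg hv1.le, ← Real.sqrt_eq_rpow, ← div_eq_mul_inv,
      div_le_div_iff₀ hpos (Real.sqrt_pos.mpr hv1)]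
    nlinarith [sqrt_le_decayRate hv, Real.sqrt_nonneg (1 - v), hv.1, hv.2]

/-- The profile `v` solves `2 v v' = decayRate v` and climbs from `0` to `1` in time `θ`. -/
lemma exists_profile (θ : ℝ) (hθ : θ = ∫ v in (0 : ℝ)..1, 2 * v / decayRate v) :
    ∃ v : ℝ → ℝ, Continuous v ∧ StrictMono v ∧ v 0 = 0 ∧ v θ = 1 ∧
      ∀ s ∈ Ioo (0 : ℝ) θ, HasDerivAt v (decayRate (v s) / (2 * v s)) s := by
  set p : ℝ → ℝ := (Ioo (0 : ℝ) 1).indicator fun v => 2 * v / decayRate v - 1 with hp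
  set q : ℝ → ℝ := fun v => 1 + p v with hq
  have hpint : Integrable p := by
    rw [hp, integrable_indicator_iff measurableSet_Ioo]
    exact integrableOn_div_decayRate.sub (integrableOn_const (by simp))
  have hqint (a b : ℝ) : IntervalIntegrable q volume a b :=
    intervalIntegrable_const.add hpint.intervalIntegrable
  have hqeq : EqOn q (fun v => 2 * v / decayRate v) (Ioo 0 1) := fun v hv => by
    simp [hq, hp, hv]
  have hqpos (v : ℝ) : 0 < q v := by
    by_cases hv : v ∈ Ioo (0 : ℝ) 1
    · rw [hqeq hv]
      exact div_pos (by linarith [hv.1]) (decayRate_pos hv)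
    · simp [hq, hp, hv]
  set F : ℝ → ℝ := fun v => ∫ t in (0 : ℝ)..v, q t with hF
  have hFc : Continuous F := continuous_primitive hqint 0
  have hFm : StrictMono F := fun a b hab => by
    rw [← sub_pos, hF]
    simp only
    rw [integral_interval_sub_left (hqint _ _) (hqint _ _)]
    exact intervalIntegral_pos_of_pos (hqint _ _) hqpos hab
  have hFsplit (v : ℝ) : F v = v + ∫ t in (0 : ℝ)..v, p t := by
    simp only [hF, hq]
    rw [integral_add intervalIntegrable_const hpint.intervalIntegrable]
    simp
  have hbound (v : ℝ) : |∫ t in (0 : ℝ)..v, p t| ≤ ∫ t, |p t| := by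
    refine (norm_integral_le_integral_norm_uIoc (f := p)).trans ?_
    exact setIntegral_le_integral hpint.norm (Filter.Eventually.of_forall fun _ => norm_nonneg _)
  have hFs : Function.Surjective F := by
    refine hFc.surjective ?_ ?_
    · refine Filter.tendsto_atTop_mono (f := fun v => v + -∫ t, |p t|) (fun v => ?_)
        (Filter.tendsto_atTop_add_const_right _ _ Filter.tendsto_id)
      linarith [hFsplit v, (abs_le.mp (hbound v)).1]
    · refine Filter.tendsto_atBot_mono (fun v => (?_ : F v ≤ v + ∫ t, |p t|))
        (Filter.tendsto_atBot_add_const_right _ _ Filter.tendsto_id)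
      linarith [hFsplit v, (abs_le.mp (hbound v)).2]
  have hF0 : F 0 = 0 := by simp [hF]
  have hF1 : F 1 = θ := by
    rw [hθ]
    simp only [hF]
    rw [integral_of_le zero_le_one, integral_of_le zero_le_one,
      integral_Ioc_eq_integral_Ioo, integral_Ioc_eq_integral_Ioo]
    exact setIntegral_congr_fun measurableSet_Ioo hqeq
  have hFd (v : ℝ) (hv : v ∈ Ioo (0 : ℝ) 1) : HasDerivAt F (2 * v / decayRate v) v := by
    refine HasDerivAt.congr_deriv ?_ (hqeq hv)
    refine integral_hasDerivAt_right (hqint _ _) ?_ ?_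
    · have := continuous_decayRate.measurable
      have hqm : Measurable q :=
        measurable_const.add (Measurable.indicator (by fun_prop) measurableSet_Ioo)
      exact hqm.stronglyMeasurable.stronglyMeasurableAtFilter
    · have hc : ContinuousAt (fun v => 2 * v / decayRate v) v :=
        ContinuousAt.div (by fun_prop) continuous_decayRate.continuousAt (decayRate_pos hv).ne'
      exact hc.congr (Filter.eventuallyEq_of_mem (isOpen_Ioo.mem_nhds hv) hqeq).symm
  set e := hFm.orderIsoOfSurjective F hFs
  have heF (v : ℝ) : e v = F v := rfl
  have hv0 : e.symm 0 = 0 := by rw [OrderIso.symm_apply_eq, heF, hF0]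
  have hv1 : e.symm θ = 1 := by rw [OrderIso.symm_apply_eq, heF, hF1]
  refine ⟨e.symm, e.symm.continuous, e.symm.strictMono, hv0, hv1, fun s hs => ?_⟩
  have hmem : e.symm s ∈ Ioo (0 : ℝ) 1 :=
    ⟨hv0 ▸ e.symm.strictMono hs.1, hv1 ▸ e.symm.strictMono hs.2⟩
  have hne : 2 * e.symm s / decayRate (e.symm s) ≠ 0 :=
    (div_pos (by linarith [hmem.1]) (decayRate_pos hmem)).ne'
  have := (hFd _ hmem).of_local_left_inverse e.symm.continuous.continuousAt hne
    (Filter.Eventually.of_forall fun y => e.apply_symm_apply y)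
  rwa [inv_div] at this

lemma hasDerivWithinAt_Icc_of_hasDerivAt_off_countable {f f' : ℝ → ℝ} {a b : ℝ} {s : Set ℝ}
    (hs : s.Countable) (hf : ContinuousOn f (Icc a b)) (hf' : ContinuousOn f' (Icc a b))
    (hd : ∀ x ∈ Ioo a b \ s, HasDerivAt f (f' x) x) {x : ℝ} (hx : x ∈ Icc a b) :
    HasDerivWithinAt f (f' x) (Icc a b) x := by
  have hab : a ≤ b := hx.1.trans hx.2
  have hg : Continuous (IccExtend hab ((Icc a b).domRestrict f')) := hf'.domRestrict.Icc_extend'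
  set g := IccExtend hab ((Icc a b).domRestrict f')
  have hgf : EqOn g f' (Icc a b) := fun y hy => by
    simp [g, IccExtend_of_mem hab _ hy, domRestrict_apply]
  have key : EqOn f (fun y => f a + ∫ t in a..y, g t) (Icc a b) := fun y hy => by
    have := integral_eq_of_hasDerivAt_off_countable_of_le f g hy.1 hs
      (hf.mono (Icc_subset_Icc_right hy.2))
      (fun z hz => by
        have hz' : z ∈ Ioo a b := ⟨hz.1.1, hz.1.2.trans_le hy.2⟩
        rw [hgf (Ioo_subset_Icc_self hz')]
        exact hd z ⟨hz', hz.2⟩) (hg.intervalIntegrable _ _)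
    simp only [this]
    ring
  rw [← hgf hx]
  exact ((hg.integral_hasStrictDerivAt a x).hasDerivAt.const_add (f a)).hasDerivWithinAt.congr
    key (key hx)

lemma exists_solution_leaving_parabola (θ : ℝ)
    (hθ : θ = ∫ v in (0 : ℝ)..1, 2 * v / decayRate v) {c : ℝ} (hc : 0 < c) :
    ∃ φ : ℝ → ℝ, φ 0 = 0 ∧
      (∀ x ∈ Icc (0 : ℝ) c, 0 ≤ φ x ∧ φ x ≤ x ^ 2 ∧
        HasDerivWithinAt φ
          (Real.sqrt (φ x) - 2 * Real.sqrt (x ^ 2 - φ x) + x) (Icc (0 : ℝ) c) x) ∧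
      (∀ x ∈ Icc (0 : ℝ) (c * Real.exp (-θ)), φ x = x ^ 2) ∧
      φ c = 0 ∧ φ c ≠ c ^ 2 := by
  obtain ⟨v, hvc, hvm, hv0, hvθ, hvd⟩ := exists_profile θ hθ
  have hθpos : 0 < θ := by
    rw [← hvm.lt_iff_lt, hv0, hvθ]
    exact one_pos
  set x₀ := c * Real.exp (-θ) with hx₀
  have hx₀pos : 0 < x₀ := by positivity
  have hx₀c : x₀ < c := mul_lt_of_lt_one_right hc (by simpa using hθpos)
  have hlog₀ : Real.log (c / x₀) = θ := by
    rw [hx₀, Real.exp_neg, ← div_eq_mul_inv, div_div_cancel₀ hc.ne', Real.log_exp]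
  set T : ℝ → ℝ := fun x => Real.log (c / max x x₀) with hT
  have hTpos (x : ℝ) : 0 < max x x₀ := lt_max_of_lt_right hx₀pos
  have hTc : Continuous T :=
    (continuous_const.div (by fun_prop) fun x => (hTpos x).ne').log
      fun x => (div_pos hc (hTpos x)).ne'
  have hT_left {x : ℝ} (hx : x ≤ x₀) : T x = θ := by simp only [hT, max_eq_right hx, hlog₀]
  have hT_le (x : ℝ) : T x ≤ θ := by
    rw [← hlog₀]
    exact Real.log_le_log (div_pos hc (hTpos x))
      (div_le_div_of_nonneg_left hc.le hx₀pos (le_max_right _ _))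
  have hT_nonneg {x : ℝ} (hx : x ≤ c) : 0 ≤ T x :=
    Real.log_nonneg ((one_le_div (hTpos x)).mpr (max_le hx hx₀c.le))
  set φ : ℝ → ℝ := fun x => x ^ 2 * v (T x) ^ 2 with hφ
  have hφc : Continuous φ := by fun_prop
  have hφ_left {x : ℝ} (hx : x ≤ x₀) : φ x = x ^ 2 := by
    simp [hφ, hT_left hx, hvθ]
  have hv_nonneg {x : ℝ} (hx : x ≤ c) : 0 ≤ v (T x) := hv0 ▸ hvm.monotone (hT_nonneg hx)
  have hv_le (x : ℝ) : v (T x) ≤ 1 := hvθ ▸ hvm.monotone (hT_le x)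
  have hφcc : φ c = 0 := by
    simp [hφ, hT, max_eq_left hx₀c.le, div_self hc.ne', hv0]
  have hderiv (x : ℝ) (hx : x ∈ Ioo 0 c \ {x₀}) :
      HasDerivAt φ (Real.sqrt (φ x) - 2 * Real.sqrt (x ^ 2 - φ x) + x) x := by
    obtain ⟨⟨hx0, hxc⟩, hne⟩ := hx
    rcases lt_or_gt_of_ne hne with hlt | hgt
    · have h2 : HasDerivAt (fun y : ℝ => y ^ 2) (2 * x) x := by
        simpa using hasDerivAt_pow 2 x
      have hE : φ =ᶠ[nhds x] fun y => y ^ 2 :=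
        Filter.eventuallyEq_of_mem (Iio_mem_nhds hlt) fun y hy => hφ_left (le_of_lt hy)
      refine (h2.congr_of_eventuallyEq hE).congr_deriv ?_
      rw [hφ_left hlt.le, Real.sqrt_sq hx0.le]
      simp
      ring
    · have hTx : T x = Real.log (c / x) := by simp only [hT, max_eq_left hgt.le]
      have hTE : T =ᶠ[nhds x] fun y => Real.log c - Real.log y := by
        refine Filter.eventuallyEq_of_mem (Ioi_mem_nhds hgt) fun y hy => ?_
        have hy : x₀ < y := hy
        simp only [hT, max_eq_left hy.le]
        exact Real.log_div hc.ne' (hx₀pos.trans hy).ne'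
      have hTd : HasDerivAt T (-x⁻¹) x :=
        ((Real.hasDerivAt_log hx0.ne').const_sub _).congr_of_eventuallyEq hTE
      have hTmem : T x ∈ Ioo 0 θ := by
        rw [hTx, ← hlog₀]
        exact ⟨Real.log_pos ((one_lt_div hx0).mpr hxc),
          Real.log_lt_log (div_pos hc hx0) (div_lt_div_of_pos_left hc hx₀pos hgt)⟩
      have hvpos : 0 < v (T x) := hv0 ▸ hvm hTmem.1
      have hφd := ((hasDerivAt_pow 2 x).mul (((hvd _ hTmem).comp x hTd).pow 2))
      refine HasDerivAt.congr_deriv (f := φ) hφd ?_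
      have h1 : √(φ x) = x * v (T x) := by
        simp only [hφ]
        rw [← mul_pow, Real.sqrt_sq (by positivity)]
      have h2 : √(x ^ 2 - φ x) = x * √(1 - v (T x) ^ 2) := by
        simp only [hφ]
        rw [show x ^ 2 - x ^ 2 * v (T x) ^ 2 = x ^ 2 * (1 - v (T x) ^ 2) by ring,
          Real.sqrt_mul (by positivity), Real.sqrt_sq hx0.le]
      rw [h1, h2]
      simp only [Pi.pow_apply, Function.comp_apply, decayRate]
      field_simp
      ring
  refine ⟨φ, by simp [hφ], fun x hx => ⟨by positivity, ?_, ?_⟩, fun x hx => hφ_left hx.2,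
    hφcc, by rw [hφcc]; positivity⟩
  · exact mul_le_of_le_one_right (by positivity) (pow_le_one₀ (hv_nonneg hx.2) (hv_le x))
  · exact hasDerivWithinAt_Icc_of_hasDerivAt_off_countable
      (f' := fun x => Real.sqrt (φ x) - 2 * Real.sqrt (x ^ 2 - φ x) + x)
      (countable_singleton x₀) hφc.continuousOn (by fun_prop) hderiv hx

lemma hasDerivWithinAt_sq_boundary {x : ℝ} (hx : 0 ≤ x) (s : Set ℝ) :
    HasDerivWithinAt (fun y : ℝ => y ^ 2)
      (Real.sqrt (x ^ 2) - 2 * Real.sqrt (x ^ 2 - x ^ 2) + x) s x := by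
  have h2 : HasDerivAt (fun y : ℝ => y ^ 2) (2 * x) x := by
    simpa using hasDerivAt_pow 2 x
  refine h2.hasDerivWithinAt.congr_deriv ?_
  rw [Real.sqrt_sq hx, sub_self, Real.sqrt_zero]
  ring

/-- Counterexample 2, hidden non-uniqueness at the origin: with
`θ = ∫₀¹ 2v/h(v) dv`, `h(v) = 2√(1 − v²) − 2(1 − v²) + (1 − v)`, for every `c > 0`
there exists a solution `φ` of `y' = √y − 2√(x² − y) + x` on `[0,c]` with graph in
`G̃ = {(x,y) : x ≥ 0, 0 ≤ y ≤ x²}`, `φ(0) = 0`, which coincides with the boundary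
solution `x²` on `[0, c·e^{−θ}]` while `φ(c) = 0 ≠ c²`; hence for every `β > 0`
there are two solutions of the boundary initial value problem at `(0,0)` on `[0,β]`
which do not coincide on `[0,β]`: the solution of BIVP(0,0) is not right locally
unique. -/
theorem counterexample2_hidden_nonuniqueness
    (h : ℝ → ℝ)
    (hh : h = fun v => 2 * Real.sqrt (1 - v ^ 2) - 2 * (1 - v ^ 2) + (1 - v))
    (θ : ℝ) (hθ : θ = ∫ v in (0 : ℝ)..1, 2 * v / h v) :
    (∀ c : ℝ, 0 < c → ∃ φ : ℝ → ℝ, φ 0 = 0 ∧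
      (∀ x ∈ Icc (0 : ℝ) c, 0 ≤ φ x ∧ φ x ≤ x ^ 2 ∧
        HasDerivWithinAt φ
          (Real.sqrt (φ x) - 2 * Real.sqrt (x ^ 2 - φ x) + x) (Icc (0 : ℝ) c) x) ∧
      (∀ x ∈ Icc (0 : ℝ) (c * Real.exp (-θ)), φ x = x ^ 2) ∧
      φ c = 0 ∧ φ c ≠ c ^ 2) ∧
    -- hence: not right locally unique at (0,0)
    (∀ β : ℝ, 0 < β → ∃ φ₁ φ₂ : ℝ → ℝ, φ₁ 0 = 0 ∧ φ₂ 0 = 0 ∧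
      (∀ x ∈ Icc (0 : ℝ) β, 0 ≤ φ₁ x ∧ φ₁ x ≤ x ^ 2 ∧
        HasDerivWithinAt φ₁
          (Real.sqrt (φ₁ x) - 2 * Real.sqrt (x ^ 2 - φ₁ x) + x) (Icc (0 : ℝ) β) x) ∧
      (∀ x ∈ Icc (0 : ℝ) β, 0 ≤ φ₂ x ∧ φ₂ x ≤ x ^ 2 ∧
        HasDerivWithinAt φ₂
          (Real.sqrt (φ₂ x) - 2 * Real.sqrt (x ^ 2 - φ₂ x) + x) (Icc (0 : ℝ) β) x) ∧
      ∃ x ∈ Icc (0 : ℝ) β, φ₁ x ≠ φ₂ x) := by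
  subst hh
  have hsol {c : ℝ} (hc : 0 < c) := exists_solution_leaving_parabola θ hθ hc
  refine ⟨fun c hc => hsol hc, fun β hβ => ?_⟩
  obtain ⟨φ, h0, hφ, -, -, hne⟩ := hsol hβ
  exact ⟨φ, fun x => x ^ 2, h0, by simp, hφ,
    fun x hx => ⟨sq_nonneg x, le_rfl, hasDerivWithinAt_sq_boundary hx.1 _⟩,
    β, ⟨hβ.le, le_rfl⟩, hne⟩
end

section
/- Example 2, branching at the origin for the extended equation: the functions y₁(x) = −x² and y₂(x) = −3x²/4 are both differentiable on [0,∞) with x² + yᵢ(x) ≥ 0 and yᵢ'(x) = √(x² + yᵢ(x)) − 2x for all x ≥ 0 (i = 1,2), they satisfy y₁(0) = y₂(0) = 0, and y₁(x) ≠ y₂(x) for every x > 0. Hence (0,0) is a non-uniqueness point of the equation y' = √(x² + y) − 2x, at which the integral curve of y₂ branches from that of the boundary solution y₁ from the right. -/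
open Set Real

/-- Example 2, branching at the origin for the extended equation: `y₁(x) = −x²`
and `y₂(x) = −3x²/4` both solve `y' = √(x² + y) − 2x` on `[0,∞)` with
`y₁(0) = y₂(0) = 0`, and `y₁(x) ≠ y₂(x)` for every `x > 0`; hence `(0,0)` is a
non-uniqueness point at which the integral curve of `y₂` branches from that of
the boundary solution `y₁` from the right. -/
theorem example2_branching_at_origin (y₁ y₂ : ℝ → ℝ)
    (hy₁ : y₁ = fun x => -x ^ 2) (hy₂ : y₂ = fun x => -(3 * x ^ 2) / 4) :
    (∀ x ∈ Ici (0 : ℝ),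
      0 ≤ x ^ 2 + y₁ x ∧
      HasDerivWithinAt y₁ (Real.sqrt (x ^ 2 + y₁ x) - 2 * x) (Ici (0 : ℝ)) x) ∧
    (∀ x ∈ Ici (0 : ℝ),
      0 ≤ x ^ 2 + y₂ x ∧
      HasDerivWithinAt y₂ (Real.sqrt (x ^ 2 + y₂ x) - 2 * x) (Ici (0 : ℝ)) x) ∧
    y₁ 0 = 0 ∧ y₂ 0 = 0 ∧
    ∀ x : ℝ, 0 < x → y₁ x ≠ y₂ x := by
  subst hy₁ hy₂
  refine ⟨fun x _ => ⟨by simp, ?_⟩, fun x hx => ⟨by nlinarith [sq_nonneg x], ?_⟩,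
    by simp, by simp, fun x hx => ?_⟩
  · have h := ((hasDerivAt_pow 2 x).neg).hasDerivWithinAt (s := Ici (0 : ℝ))
    have e : Real.sqrt (x ^ 2 + -x ^ 2) - 2 * x = -(((2 : ℕ) : ℝ) * x ^ (2 - 1)) := by simp
    exact e ▸ h
  · have hx : 0 ≤ x := hx
    have hsqrt : Real.sqrt (x ^ 2 + -(3 * x ^ 2) / 4) = x / 2 := by
      rw [show x ^ 2 + -(3 * x ^ 2) / 4 = (x / 2) ^ 2 by ring]
      exact Real.sqrt_sq (by positivity)
    have h := ((((hasDerivAt_pow 2 x).const_mul 3).neg).div_const 4).hasDerivWithinAt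
      (s := Ici (0 : ℝ))
    have e : Real.sqrt (x ^ 2 + -(3 * x ^ 2) / 4) - 2 * x =
        -(3 * (((2 : ℕ) : ℝ) * x ^ (2 - 1))) / 4 := by
      rw [hsqrt]
      norm_num
      ring
    exact e ▸ h
  · have : 0 < x ^ 2 := by positivity
    intro h
    dsimp only at h
    linarith
end

section
/- Example 3, failure of the Lipschitz condition near the origin: let G̃ = {(x,y) : x ≥ 0, |y| ≥ x²} and f(x,y) = 2(|y| − x²)^{3/2} + x·sign(y) for (x,y) ∈ G̃ (with sign(y) = 1 for y > 0, −1 for y < 0, 0 for y = 0). Then f does not satisfy a Lipschitz condition with respect to y on any neighborhood of the origin intersected with G̃: for all constants L > 0 and c > 0 there exists x ∈ (0, c] such that the points (x, x²) and (x, −x²) lie in G̃ ∩ ([−c,c] × [−c,c]) and |f(x, x²) − f(x, −x²)| > L·|x² − (−x²)|. -/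
open Set Real

/-- Example 3, failure of the Lipschitz condition near the origin: on
`G̃ = {(x,y) : x ≥ 0, |y| ≥ x²}`, the function
`f(x,y) = 2(|y| − x²)^{3/2} + x·sign(y)` satisfies no Lipschitz condition in `y`
on any neighborhood of the origin intersected with `G̃`: for all `L > 0` and
`c > 0` there is `x ∈ (0, c]` with `(x, x²), (x, −x²) ∈ G̃ ∩ ([−c,c] × [−c,c])`
and `|f(x, x²) − f(x, −x²)| > L·|x² − (−x²)|`. -/
theorem example3_lipschitz_fails
    (Gt : Set (ℝ × ℝ)) (hGt : Gt = {p : ℝ × ℝ | 0 ≤ p.1 ∧ p.1 ^ 2 ≤ |p.2|})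
    (f : ℝ × ℝ → ℝ)
    (hf : ∀ p ∈ Gt, f p = 2 * (|p.2| - p.1 ^ 2) ^ ((3 : ℝ) / 2) + p.1 * Real.sign p.2) :
    ∀ L > 0, ∀ c > 0, ∃ x ∈ Ioc (0 : ℝ) c,
      (x, x ^ 2) ∈ Gt ∩ (Icc (-c) c ×ˢ Icc (-c) c) ∧
      (x, -x ^ 2) ∈ Gt ∩ (Icc (-c) c ×ˢ Icc (-c) c) ∧
      L * |x ^ 2 - (-x ^ 2)| < |f (x, x ^ 2) - f (x, -x ^ 2)| := by
  intro L hL c hc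
  obtain ⟨x, hx0, hx⟩ : ∃ x : ℝ, 0 < x ∧ x < min (min c 1) (1 / L) :=
    exists_between (by positivity)
  obtain ⟨⟨hxc, hx1⟩, hxL⟩ : (x < c ∧ x < 1) ∧ x < 1 / L := by
    simpa only [lt_min_iff] using hx
  have hsq : 0 < x ^ 2 := by positivity
  have hsqc : x ^ 2 ≤ c := by nlinarith
  have habs : |x ^ 2| = x ^ 2 := abs_of_pos hsq
  have hmem : (x, x ^ 2) ∈ Gt := by
    rw [hGt]
    exact ⟨hx0.le, habs.ge⟩
  have hmem_neg : (x, -x ^ 2) ∈ Gt := by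
    rw [hGt]
    exact ⟨hx0.le, by simp only [abs_neg, habs, le_refl]⟩
  have hval : f (x, x ^ 2) = x := by
    rw [hf _ hmem]
    simp [habs, Real.sign_of_pos hsq]
  have hval_neg : f (x, -x ^ 2) = -x := by
    rw [hf _ hmem_neg]
    simp [habs, Real.sign_of_neg (neg_lt_zero.mpr hsq)]
  have hLx : x * L < 1 := (lt_div_iff₀ hL).mp hxL
  refine ⟨x, ⟨hx0, hxc.le⟩, ⟨hmem, ⟨by linarith, hxc.le⟩, ⟨by linarith, hsqc⟩⟩,
    ⟨hmem_neg, ⟨by linarith, hxc.le⟩, ⟨by linarith, by linarith⟩⟩, ?_⟩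
  rw [hval, hval_neg, abs_of_pos (by linarith), abs_of_pos (by linarith)]
  nlinarith
end
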